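/- arXiv:1703.00282 — 2 statements merged into one kernel-verified Lean document; each statement's English description precedes it below -/
import Mathlib

section
/- Let μ be a positive Borel measure on ℝ with μ(ℝ) = ∞ and μ(I) < ∞ for every bounded interval I, satisfying condition (H). Let (E,d) be a complete metric space, p ≥ 1, and f : ℝ → E locally p-integrable. If g₁ and g₂ are both S^p-almost periodic functions from ℝ to E such that, for i = 1, 2, the function t ↦ (∫_0^1 d(f(t+s), g_i(t+s))^p ds)^{1/p} is μ-ergodic, then g₁(t) = g₂(t) for Lebesgue-almost every t ∈ ℝ. -/
open MeasureTheory Filter Topology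

/-- A set `A ⊆ ℝ` is relatively dense. -/
def RelDense (A : Set ℝ) : Prop := ∃ l > 0, ∀ a : ℝ, ∃ τ ∈ A, τ ∈ Set.Icc a (a + l)

/-- `f` is Stepanov almost periodic of order `p`. -/
def SpAP {E : Type*} [PseudoMetricSpace E] (p : ℝ) (f : ℝ → E) : Prop :=
  ∀ ε > 0, RelDense {τ : ℝ | ∀ x : ℝ,
    (∫ t in x..(x + 1), dist (f (t + τ)) (f t) ^ p) ^ (1 / p) ≤ ε}

/-- Local `p`-integrability of a metric-space valued function. -/
def LocInt {E : Type*} [PseudoMetricSpace E] (p : ℝ) (f : ℝ → E) : Prop :=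
  ∀ (x₀ : E) (a b : ℝ), IntervalIntegrable (fun t => dist (f t) x₀ ^ p) volume a b

/-- Condition (H) on the measure `μ`. -/
def CondH (μ : Measure ℝ) : Prop :=
  ∀ τ : ℝ, ∃ β > (0:ℝ), ∃ a b : ℝ, ∀ A : Set ℝ, MeasurableSet A → A ∩ Set.Icc a b = ∅ →
    μ ((fun t => t + τ) '' A) ≤ ENNReal.ofReal β * μ A

/-- `φ : ℝ → ℝ` is `μ`-ergodic. -/
def MuErgodic (μ : Measure ℝ) (φ : ℝ → ℝ) : Prop :=
  Tendsto (fun r : ℝ => (1 / (μ (Set.Icc (-r) r)).toReal) *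
      ∫ t in Set.Icc (-r) r, φ t ∂μ) atTop (𝓝 0)

open Cardinal in
/-- A finite measure on a Polish space charging a Borel set on which a continuous map has null
fibers cannot make all preimages of sets under this map measurable. -/
theorem false_of_continuous_of_null_fibers {X : Type} [TopologicalSpace X] [PolishSpace X]
    [MeasurableSpace X] [BorelSpace X] (ν : Measure X) [IsFiniteMeasure ν] {A : Set X}
    (hA : MeasurableSet A) (hpos : 0 < ν A) {k : X → ℝ} (hk : Continuous k)
    (hnull : ∀ y, ν (A ∩ k ⁻¹' {y}) = 0) (hall : ∀ S : Set ℝ, MeasurableSet (A ∩ k ⁻¹' S)) :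
    False := by
  let := TopologicalSpace.upgradeIsCompletelyMetrizable X
  obtain ⟨K, hKA, ⟨hK, -⟩, hKpos⟩ :=
    (innerRegular_isCompact_isClosed_measurableSet_of_finite ν) hA 0 hpos
  have hunc : ¬ (k '' K).Countable := by
    intro hc
    have : ν K = 0 := by
      refine measure_mono_null (t := ⋃ y ∈ k '' K, A ∩ k ⁻¹' {y}) ?_
        ((measure_biUnion_null_iff hc).2 fun y _ => hnull y)
      intro x hx
      simp only [Set.mem_iUnion]
      exact ⟨k x, ⟨x, hx, rfl⟩, hKA hx, rfl⟩
    exact hKpos.ne' this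
  obtain ⟨c, hcK, -, hc⟩ :=
    (hK.image hk).isClosed.exists_nat_bool_injection_of_not_countable hunc
  let F : Set (ℕ → Bool) → {s : Set X // MeasurableSet s} := fun S => ⟨A ∩ k ⁻¹' (c '' S), hall _⟩
  have hF : Function.Injective F := by
    intro S T h
    have h' : A ∩ k ⁻¹' (c '' S) = A ∩ k ⁻¹' (c '' T) := congrArg Subtype.val h
    ext z
    obtain ⟨x, hx, hxz⟩ := hcK ⟨z, rfl⟩
    have := Set.ext_iff.1 h' x
    simpa [hKA hx, hxz, hc.eq_iff] using this
  have h1 := Cardinal.mk_le_of_injective hF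
  have h2 : #{s : Set X // MeasurableSet s} ≤ 𝔠 := by
    obtain ⟨b, hb, hb'⟩ := MeasurableSpace.CountablyGenerated.isCountablyGenerated (α := X)
    subst hb'
    exact MeasurableSpace.cardinal_measurableSet_le_continuum (hb.le_aleph0.trans aleph0_le_continuum)
  have h3 : #(Set (ℕ → Bool)) = 2 ^ 𝔠 := by simp
  exact absurd (h3 ▸ h1.trans h2) (Cardinal.cantor 𝔠).not_ge

/-- If every preimage of a set under `k` is Borel, then `k` takes countably many values almost
everywhere. -/
theorem exists_countable_null_of_measurableSet_preimage {I : Type*} {A : Set ℝ} {k : ℝ → I}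
    (hall : ∀ S : Set I, MeasurableSet (A ∩ k ⁻¹' S)) (ν : Measure ℝ) [IsFiniteMeasure ν] :
    ∃ J : Set I, J.Countable ∧ ν (A ∩ k ⁻¹' Jᶜ) = 0 := by
  classical
  refine ⟨{i | 0 < ν (A ∩ k ⁻¹' {i})}, ?_, ?_⟩
  · refine Measure.countable_meas_pos_of_disjoint_iUnion (fun i => hall {i}) ?_
    intro i j hij
    refine Set.disjoint_left.2 fun x hx hy => hij ?_
    exact (hx.2 : k x = i).symm.trans hy.2
  · by_contra hne
    set J : Set I := {i | 0 < ν (A ∩ k ⁻¹' {i})} with hJ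
    set A' := A ∩ k ⁻¹' Jᶜ with hA'
    obtain ⟨ρ, hρ⟩ : ∃ ρ : I → ℝ, ∀ x, k (ρ (k x)) = k x := by
      refine ⟨fun i => if h : ∃ x, k x = i then h.choose else 0, fun x => ?_⟩
      have h : ∃ y, k y = k x := ⟨x, rfl⟩
      simp only [h, dif_pos]
      exact h.choose_spec
    let q : ℝ → ℝ := fun x => if x ∈ A then ρ (k x) else 0
    have hAm : MeasurableSet A := by simpa using hall Set.univ
    have hq' : ∀ S : Set ℝ, A' ∩ q ⁻¹' S = A ∩ k ⁻¹' (Jᶜ ∩ ρ ⁻¹' S) := by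
      intro S
      ext x
      by_cases hx : x ∈ A <;> simp [A', q, hx]
    have hq : Measurable q := by
      intro S hS
      have : q ⁻¹' S = (A ∩ k ⁻¹' (ρ ⁻¹' S)) ∪ (Aᶜ ∩ {x | (0:ℝ) ∈ S}) := by
        ext x
        by_cases hx : x ∈ A <;> simp [q, hx]
      rw [this]
      exact (hall _).union (hAm.compl.inter (MeasurableSet.const _))
    have hborel := BorelSpace.measurable_eq (α := ℝ)
    have hpolish : PolishSpace ℝ := inferInstance
    obtain ⟨t', hle, hcont, hpol⟩ := hq.exists_continuous
    have hb : @BorelSpace ℝ t' _ := by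
      refine @BorelSpace.mk ℝ t' _ ?_
      exact hborel.trans (borel_eq_borel_of_le hpol hpolish hle).symm
    refine @false_of_continuous_of_null_fibers ℝ t' hpol _ hb ν _ A' (hall _)
      (pos_iff_ne_zero.2 hne) q hcont ?_ ?_
    · intro y
      rw [hq']
      by_cases hy : k y ∈ J
      · convert measure_empty (μ := ν)
        ext x
        simp only [Set.mem_inter_iff, Set.mem_preimage, Set.mem_compl_iff, Set.mem_singleton_iff,
          Set.mem_empty_iff_false, iff_false, not_and]
        rintro - h1 rfl
        exact h1 (hρ x ▸ hy)
      · have : ν (A ∩ k ⁻¹' {k y}) = 0 := by simpa [J] using hy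
        refine measure_mono_null ?_ this
        rintro x ⟨h1, h2, rfl⟩
        exact ⟨h1, (hρ x).symm⟩
    · intro S
      rw [hq']
      exact hall _

/-- A Borel map from the line to a metric space, separable or not, is almost everywhere strongly
measurable. -/
theorem aestronglyMeasurable_of_measurable_real {E : Type*} [MetricSpace E]
    [MeasurableSpace E] [OpensMeasurableSpace E] {g : ℝ → E} (hg : Measurable g)
    (ν : Measure ℝ) [IsFiniteMeasure ν] : AEStronglyMeasurable g ν := by
  have key : ∀ ε > 0, ∃ s : Set E, s.Countable ∧
      ∀ᵐ x ∂ν, ∃ y ∈ s, dist (g x) y < ε := by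
    intro ε hε
    let : LinearOrder E := IsWellOrder.linearOrder WellOrderingRel
    have : WellFoundedLT E := ⟨WellOrderingRel.isWellOrder.wf⟩
    let C : ℕ → E → Set E := fun n i =>
      Metric.closedBall i (ε - 1 / (n + 1)) \ ⋃ j < i, Metric.ball j ε
    have hCball : ∀ n i y, y ∈ C n i → dist y i < ε := by
      intro n i y hy
      have := hy.1
      rw [Metric.mem_closedBall] at this
      have : (0:ℝ) < 1 / (n + 1) := by positivity
      linarith
    have hsep' : ∀ n i j y z, j < i → y ∈ C n i → z ∈ C n j → 1 / ((n:ℝ) + 1) ≤ dist y z := by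
      intro n i j y z hij hy hz
      have h1 := hz.1
      rw [Metric.mem_closedBall] at h1
      have h2 : ε ≤ dist y j := by
        by_contra h
        exact hy.2 (Set.mem_biUnion hij (by simpa using h))
      have := dist_triangle y z j
      linarith
    have hsep : ∀ n i j y z, i ≠ j → y ∈ C n i → z ∈ C n j → 1 / ((n:ℝ) + 1) ≤ dist y z := by
      intro n i j y z hij hy hz
      rcases lt_or_gt_of_ne hij with h | h
      · rw [dist_comm]
        exact hsep' n j i z y h hz hy
      · exact hsep' n i j y z h hy hz
    have hclosed : ∀ n (J : Set E), IsClosed (⋃ i ∈ J, C n i) := by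
      intro n J
      rw [Set.biUnion_eq_iUnion]
      refine LocallyFinite.isClosed_iUnion ?_ ?_
      · intro y
        refine ⟨Metric.ball y (1 / (n + 1) / 2), Metric.ball_mem_nhds _ (by positivity), ?_⟩
        refine Set.Subsingleton.finite ?_
        rintro i ⟨a, ha, ha'⟩ j ⟨b, hb, hb'⟩
        by_contra hij
        have := hsep n i j a b (fun h => hij (Subtype.ext h)) ha hb
        rw [Metric.mem_ball] at ha' hb'
        have := dist_triangle_right a b y
        linarith
      · intro i
        exact Metric.isClosed_closedBall.sdiff
          (isOpen_biUnion fun _ _ => Metric.isOpen_ball)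
    have hcov : ∀ y, ∃ n i, y ∈ C n i := by
      intro y
      have hne : {i : E | dist y i < ε}.Nonempty := ⟨y, by simpa using hε⟩
      have hmem := WellFounded.min_mem (wellFounded_lt (α := E)) _ hne
      set i := WellFounded.min (wellFounded_lt (α := E)) _ hne
      obtain ⟨n, hn⟩ := exists_nat_one_div_lt (sub_pos.2 hmem : (0:ℝ) < ε - dist y i)
      refine ⟨n, i, ?_, ?_⟩
      · rw [Metric.mem_closedBall]
        linarith
      · simp only [Set.mem_iUnion, not_exists]
        intro j hj hyj
        exact WellFounded.not_lt_min (wellFounded_lt (α := E)) _ (x := j) hyj hj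
    have hk : ∀ n, ∃ k : E → E, ∀ y i, y ∈ C n i → k y = i := by
      intro n
      classical
      refine ⟨fun y => if h : ∃ i, y ∈ C n i then h.choose else y, fun y i hy => ?_⟩
      have h : ∃ i, y ∈ C n i := ⟨i, hy⟩
      simp only [h, dif_pos]
      by_contra hne
      have h1 := hsep n _ _ y y hne h.choose_spec hy
      rw [dist_self] at h1
      have : (0:ℝ) < 1 / (n + 1) := by positivity
      linarith
    choose k hk using hk
    have hJ : ∀ n, ∃ J : Set E, J.Countable ∧
        ν ((g ⁻¹' ⋃ i ∈ Set.univ, C n i) ∩ (k n ∘ g) ⁻¹' Jᶜ) = 0 := by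
      intro n
      refine exists_countable_null_of_measurableSet_preimage (fun S => ?_) ν
      have : (g ⁻¹' ⋃ i ∈ Set.univ, C n i) ∩ (k n ∘ g) ⁻¹' S = g ⁻¹' ⋃ i ∈ S, C n i := by
        ext x
        simp only [Set.mem_inter_iff, Set.mem_preimage, Set.mem_iUnion, Function.comp]
        constructor
        · rintro ⟨⟨i, -, hi⟩, h2⟩
          exact ⟨i, hk n _ _ hi ▸ h2, hi⟩
        · rintro ⟨i, hi, hi'⟩
          exact ⟨⟨i, trivial, hi'⟩, (hk n _ _ hi').symm ▸ hi⟩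
      rw [this]
      exact hg (hclosed n S).measurableSet
    choose J hJc hJ0 using hJ
    refine ⟨⋃ n, J n, Set.countable_iUnion hJc, ?_⟩
    have := ae_all_iff.2 fun n => measure_eq_zero_iff_ae_notMem.1 (hJ0 n)
    filter_upwards [this] with x hx
    obtain ⟨n, i, hi⟩ := hcov (g x)
    refine ⟨i, Set.mem_iUnion.2 ⟨n, ?_⟩, hCball _ _ _ hi⟩
    by_contra h
    refine hx n ⟨?_, ?_⟩
    · exact Set.mem_biUnion trivial hi
    · simpa [hk n _ _ hi] using h
  choose! s hsc hs using key
  have hae := ae_all_iff.2 fun n : ℕ => hs (1 / ((n:ℝ) + 1)) (by positivity)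
  have hsep : TopologicalSpace.IsSeparable
      {y : E | ∀ n : ℕ, ∃ z ∈ s (1 / ((n:ℝ) + 1)), dist y z < 1 / ((n:ℝ) + 1)} := by
    refine ⟨⋃ n : ℕ, s (1 / ((n:ℝ) + 1)), Set.countable_iUnion fun n => hsc _ (by positivity), ?_⟩
    intro y hy
    rw [Metric.mem_closure_iff]
    intro ε hε
    obtain ⟨n, hn⟩ := exists_nat_one_div_lt hε
    obtain ⟨z, hz, hz'⟩ := hy n
    exact ⟨z, Set.mem_iUnion.2 ⟨n, hz⟩, hz'.trans hn⟩
  have hgb : @Measurable ℝ E _ (borel E) g := hg.mono le_rfl OpensMeasurableSpace.borel_le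
  let := borel E
  have : BorelSpace E := ⟨rfl⟩
  exact aestronglyMeasurable_iff_aemeasurable_separable.2 ⟨hgb.aemeasurable, _, hsep, hae⟩

/-- Bohr almost periodicity of a function with values in a pseudometric space. Continuity is not
part of the definition. -/
def BohrAP {X : Type*} [PseudoMetricSpace X] (u : ℝ → X) : Prop :=
  ∀ ε > 0, RelDense {τ : ℝ | ∀ x : ℝ, dist (u (x + τ)) (u x) ≤ ε}

theorem RelDense.mono {A B : Set ℝ} (h : A ⊆ B) (hA : RelDense A) : RelDense B := by
  obtain ⟨l, hl, H⟩ := hA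
  refine ⟨l, hl, fun a => ?_⟩
  obtain ⟨τ, hτ, hτ'⟩ := H a
  exact ⟨τ, h hτ, hτ'⟩

theorem BohrAP.uniformContinuous {X : Type*} [PseudoMetricSpace X] {u : ℝ → X} (hu : BohrAP u)
    (hc : Continuous u) : UniformContinuous u := by
  rw [Metric.uniformContinuous_iff]
  intro ε hε
  obtain ⟨l, hl, H⟩ := hu (ε / 4) (by positivity)
  have hK : UniformContinuousOn u (Set.Icc (-1) (l + 1)) :=
    isCompact_Icc.uniformContinuousOn_of_continuous hc.continuousOn
  obtain ⟨δ, hδ, hK⟩ := Metric.uniformContinuousOn_iff.1 hK (ε / 4) (by positivity)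
  refine ⟨min δ 1, by positivity, fun {x y} hxy => ?_⟩
  obtain ⟨τ, hτ, hτ1, hτ2⟩ := H (-x)
  have hxy1 : |x - y| < 1 := hxy.trans_le (min_le_right _ _)
  rw [abs_lt] at hxy1
  have h1 := hτ x
  have h2 := hτ y
  have h3 : dist (u (x + τ)) (u (y + τ)) < ε / 4 := by
    refine hK _ ⟨by linarith, by linarith⟩ _ ⟨by linarith, by linarith⟩ ?_
    simpa using hxy.trans_le (min_le_left _ _)
  have h4 := dist_triangle4_right (u x) (u y) (u (x + τ)) (u (y + τ))
  rw [dist_comm (u x) (u (x + τ)), dist_comm (u y) (u (y + τ))] at h4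
  linarith

/-- Continuous almost periodic functions have common almost periods. -/
theorem BohrAP.prodMk {X Y : Type*} [PseudoMetricSpace X] [PseudoMetricSpace Y] {u : ℝ → X}
    {v : ℝ → Y} (hu : BohrAP u) (hv : BohrAP v) (hvc : Continuous v) :
    BohrAP fun x => (u x, v x) := by
  intro ε hε
  obtain ⟨δ, hδ, hδv⟩ := Metric.uniformContinuous_iff.1 (hv.uniformContinuous hvc) (ε / 3)
    (by positivity)
  obtain ⟨l₁, hl₁, H₁⟩ := hu (ε / 3) (by positivity)
  obtain ⟨l₂, hl₂, H₂⟩ := hv (ε / 3) (by positivity)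
  choose σ hσ hσI using H₁
  choose ρ hρ hρI using H₂
  let bin : ℝ → ℤ := fun a => ⌊(σ a - ρ a) / δ⌋
  have hfin : (Set.range bin).Finite := by
    refine (Set.finite_Icc ⌊-l₂ / δ⌋ ⌊l₁ / δ⌋).subset ?_
    rintro _ ⟨a, rfl⟩
    obtain ⟨h1, h2⟩ := hσI a
    obtain ⟨h3, h4⟩ := hρI a
    constructor <;> refine Int.floor_le_floor ?_ <;> gcongr <;> linarith
  obtain ⟨rep, hrep⟩ : ∃ rep : ℤ → ℝ, ∀ a, bin (rep (bin a)) = bin a := by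
    classical
    refine ⟨fun i => if h : ∃ x, bin x = i then h.choose else 0, fun x => ?_⟩
    have h : ∃ y, bin y = bin x := ⟨x, rfl⟩
    simp only [h, dif_pos]
    exact h.choose_spec
  obtain ⟨M, hM⟩ : ∃ M, ∀ a, |σ (rep (bin a))| ≤ M := by
    have := (hfin.image fun i => |σ (rep i)|).bddAbove
    obtain ⟨M, hM⟩ := this
    exact ⟨M, fun a => hM ⟨_, ⟨a, rfl⟩, rfl⟩⟩
  have hM0 : 0 ≤ M := (abs_nonneg _).trans (hM 0)
  refine ⟨l₁ + 2 * M, by positivity, fun a => ?_⟩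
  set c := a + M with hc
  set d := rep (bin c) with hd
  have hMd := abs_le.1 (hM c)
  refine ⟨σ c - σ d, ?_, ?_⟩
  swap
  · have := hσI c
    constructor <;> linarith [this.1, this.2, hMd.1, hMd.2]
  have hper : ∀ x, dist (u (x + (σ c - σ d))) (u x) ≤ ε := by
    intro x
    have h1 := hσ c (x - σ d)
    have h2 := hσ d (x - σ d)
    rw [sub_add_cancel] at h2
    rw [show x - σ d + σ c = x + (σ c - σ d) by ring] at h1
    have := dist_triangle_right (u (x + (σ c - σ d))) (u x) (u (x - σ d))
    linarith
  have hclose : |(σ c - ρ c) - (σ d - ρ d)| < δ := by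
    have := Int.abs_sub_lt_one_of_floor_eq_floor (hrep c).symm
    rw [← sub_div, abs_div, abs_of_pos hδ, div_lt_one hδ] at this
    exact this
  intro x
  rw [Prod.dist_eq]
  refine max_le (hper x) ?_
  have h1 := hρ c (x - ρ d)
  have h2 := hρ d (x - ρ d)
  rw [sub_add_cancel] at h2
  have h3 : dist (v (x + (σ c - σ d))) (v (x - ρ d + ρ c)) < ε / 3 := by
    apply hδv
    rw [Real.dist_eq]
    convert hclose using 2
    ring
  have := dist_triangle4 (v (x + (σ c - σ d))) (v (x - ρ d + ρ c)) (v (x - ρ d)) (v x)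
  rw [dist_comm (v (x - ρ d)) (v x)] at this
  linarith

theorem BohrAP.dist {X : Type*} [PseudoMetricSpace X] {u v : ℝ → X} (hu : BohrAP u)
    (hv : BohrAP v) (hvc : Continuous v) : BohrAP fun x => dist (u x) (v x) := by
  intro ε hε
  refine (hu.prodMk hv hvc (ε / 2) (by positivity)).mono fun τ hτ x => ?_
  have h := hτ x
  rw [Prod.dist_eq, max_le_iff] at h
  have := _root_.dist_dist_dist_le (u (x + τ)) (v (x + τ)) (u x) (v x)
  linarith [h.1, h.2]

/-- Where an almost periodic function is positive, finitely many bounded translates of a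
superlevel set cover the line. -/
theorem BohrAP.exists_finset_shift {W : ℝ → ℝ} (hW : BohrAP W) (hc : Continuous W) {x₀ : ℝ}
    (hx₀ : 0 < W x₀) : ∃ F : Finset ℝ, ∀ x, ∃ s ∈ F, W x₀ / 4 ≤ W (x + s) := by
  obtain ⟨l, hl, H⟩ := hW (W x₀ / 4) (by positivity)
  obtain ⟨δ, hδ, hδW⟩ := Metric.continuous_iff.1 hc x₀ (W x₀ / 4) (by positivity)
  obtain ⟨N, hN⟩ := exists_nat_gt (l / δ)
  classical
  refine ⟨(Finset.range (N + 1)).image fun n : ℕ => x₀ + n * δ, fun x => ?_⟩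
  obtain ⟨τ, hτ, hτ1, hτ2⟩ := H x
  have h0 : 0 ≤ (τ - x) / δ := div_nonneg (by linarith) hδ.le
  have hfl := Nat.floor_le h0
  have hfl' := Nat.lt_floor_add_one ((τ - x) / δ)
  set n := ⌊(τ - x) / δ⌋₊
  rw [le_div_iff₀ hδ] at hfl
  rw [div_lt_iff₀ hδ] at hfl'
  refine ⟨x₀ + n * δ, Finset.mem_image_of_mem _ (Finset.mem_range.2 ?_), ?_⟩
  · have : (n : ℝ) < N := by
      refine lt_of_le_of_lt ?_ hN
      rw [le_div_iff₀ hδ]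
      linarith
    have : n < N := by exact_mod_cast this
    omega
  · have h1 := hτ (x + (x₀ + n * δ) - τ)
    rw [sub_add_cancel, Real.dist_eq, abs_le] at h1
    have h2 : |W (x + (x₀ + n * δ) - τ) - W x₀| < W x₀ / 4 := by
      refine hδW _ ?_
      rw [Real.dist_eq, abs_lt]
      constructor <;> linarith
    rw [abs_lt] at h2
    linarith [h1.1, h2.1]

theorem CondH.exists_measure_image_le {μ : Measure ℝ} (hμ : ∀ a b : ℝ, μ (Set.Icc a b) < ⊤)
    (hH : CondH μ) (τ : ℝ) : ∃ β C : ℝ, 0 ≤ β ∧ 0 ≤ C ∧ ∀ A : Set ℝ, MeasurableSet A →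
      μ ((fun t => t + τ) '' A) ≤ ENNReal.ofReal β * μ A + ENNReal.ofReal C := by
  obtain ⟨β, hβ, a, b, h⟩ := hH τ
  refine ⟨β, (μ (Set.Icc (a + τ) (b + τ))).toReal, hβ.le, ENNReal.toReal_nonneg,
    fun A hA => ?_⟩
  rw [ENNReal.ofReal_toReal (hμ _ _).ne]
  calc μ ((fun t => t + τ) '' A)
      ≤ μ ((fun t => t + τ) '' (A \ Set.Icc a b) ∪ Set.Icc (a + τ) (b + τ)) := by
        refine measure_mono ?_
        rintro _ ⟨t, ht, rfl⟩
        by_cases htI : t ∈ Set.Icc a b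
        · right
          exact ⟨by linarith [htI.1], by linarith [htI.2]⟩
        · exact Or.inl ⟨t, ⟨ht, htI⟩, rfl⟩
    _ ≤ μ ((fun t => t + τ) '' (A \ Set.Icc a b)) + μ (Set.Icc (a + τ) (b + τ)) :=
        measure_union_le _ _
    _ ≤ ENNReal.ofReal β * μ A + μ (Set.Icc (a + τ) (b + τ)) := by
        gcongr
        refine (h _ (hA.diff measurableSet_Icc) (by simp)).trans ?_
        gcongr
        exact Set.sdiff_subset

theorem tendsto_measure_Icc_toReal {μ : Measure ℝ} (hμ1 : μ Set.univ = ⊤)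
    (hμ2 : ∀ a b : ℝ, μ (Set.Icc a b) < ⊤) :
    Tendsto (fun r : ℝ => (μ (Set.Icc (-r) r)).toReal) atTop atTop := by
  have hmono : Monotone fun r : ℝ => Set.Icc (-r) r := fun a b hab =>
    Set.Icc_subset_Icc (by linarith) hab
  have hU : ⋃ r : ℝ, Set.Icc (-r) r = Set.univ := by
    refine Set.eq_univ_of_forall fun x => Set.mem_iUnion.2 ⟨|x|, ?_⟩
    exact abs_le.1 le_rfl
  have h := tendsto_measure_iUnion_atTop (μ := μ) hmono
  rw [hU, hμ1] at h
  rw [tendsto_atTop]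
  intro b
  filter_upwards [h.eventually (lt_mem_nhds (ENNReal.ofReal_lt_top (r := b)))] with r hr
  exact (ENNReal.ofReal_le_iff_le_toReal (hμ2 _ _).ne).1 hr.le

/-- A nonnegative continuous almost periodic function with zero `μ`-mean vanishes. -/
theorem BohrAP.eq_zero_of_muErgodic {μ : Measure ℝ} (hμ1 : μ Set.univ = ⊤)
    (hμ2 : ∀ a b : ℝ, μ (Set.Icc a b) < ⊤) (hH : CondH μ) {W : ℝ → ℝ} (hW : BohrAP W)
    (hc : Continuous W) (h0 : ∀ x, 0 ≤ W x) (herg : MuErgodic μ W) (x₀ : ℝ) : W x₀ = 0 := by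
  by_contra hne
  have hpos : 0 < W x₀ := lt_of_le_of_ne (h0 x₀) (Ne.symm hne)
  obtain ⟨F, hF⟩ := hW.exists_finset_shift hc hpos
  obtain ⟨L, hL⟩ : ∃ L, ∀ s ∈ F, |s| ≤ L := by
    obtain ⟨L, hL⟩ := (F.image fun s => |s|).bddAbove
    exact ⟨L, fun s hs => hL (Finset.mem_coe.2 (Finset.mem_image_of_mem _ hs))⟩
  obtain ⟨s₀, hs₀, -⟩ := hF 0
  have hL0 : 0 ≤ L := (abs_nonneg _).trans (hL _ hs₀)
  let B : Set ℝ := {x | W x₀ / 4 ≤ W x}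
  have hB : MeasurableSet B := (isClosed_le continuous_const hc).measurableSet
  let G : Finset ℝ := F.image (fun s => s + L) ∪ F.image (fun s => s - L)
  choose β C hβ hC hβC using hH.exists_measure_image_le hμ2
  have hcover : ∀ r, 2 * L ≤ r →
      Set.Icc (-r) r ⊆ ⋃ s ∈ G, (fun t => t + -s) '' (B ∩ Set.Icc (-r) r) := by
    rintro r hr x ⟨hx1, hx2⟩
    simp only [Set.mem_iUnion]
    rcases le_total x 0 with hx | hx
    · obtain ⟨s, hs, hs'⟩ := hF (x + L)
      have := abs_le.1 (hL s hs)
      refine ⟨s + L, by simp [G, hs], x + (s + L), ⟨?_, ?_, ?_⟩, by ring⟩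
      · simpa [B, add_assoc, add_comm L s] using hs'
      · linarith
      · linarith
    · obtain ⟨s, hs, hs'⟩ := hF (x - L)
      have := abs_le.1 (hL s hs)
      refine ⟨s - L, by simp [G, hs], x + (s - L), ⟨?_, ?_, ?_⟩, by ring⟩
      · change W x₀ / 4 ≤ W _
        convert hs' using 2
        ring
      · linarith
      · linarith
  set m : ℝ → ℝ := fun r => (μ (Set.Icc (-r) r)).toReal with hm
  set bb := ∑ s ∈ G, β (-s)
  set cc := ∑ s ∈ G, C (-s)
  have hbb : 0 ≤ bb := Finset.sum_nonneg fun s _ => hβ _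
  have hint : ∀ r, IntegrableOn W (Set.Icc (-r) r) μ := by
    intro r
    have : IsFiniteMeasure (μ.restrict (Set.Icc (-r) r)) := ⟨by simpa using hμ2 _ _⟩
    obtain ⟨K, hK⟩ := isCompact_Icc.exists_bound_of_continuousOn (hc.continuousOn (s := Set.Icc (-r) r))
    exact Integrable.of_bound hc.aestronglyMeasurable K
      ((ae_restrict_iff' measurableSet_Icc).2 (Eventually.of_forall hK))
  have hineq : ∀ r, 2 * L ≤ r →
      m r ≤ bb * (4 / W x₀) * (∫ t in Set.Icc (-r) r, W t ∂μ) + cc := by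
    intro r hr
    have hfin : μ (B ∩ Set.Icc (-r) r) ≠ ⊤ :=
      ((measure_mono Set.inter_subset_right).trans_lt (hμ2 _ _)).ne
    have h1 : μ (Set.Icc (-r) r) ≤
        ENNReal.ofReal (bb * (μ (B ∩ Set.Icc (-r) r)).toReal + cc) := by
      calc μ (Set.Icc (-r) r)
          ≤ ∑ s ∈ G, μ ((fun t => t + -s) '' (B ∩ Set.Icc (-r) r)) :=
            (measure_mono (hcover r hr)).trans (measure_biUnion_finset_le _ _)
        _ ≤ ∑ s ∈ G, ENNReal.ofReal (β (-s) * (μ (B ∩ Set.Icc (-r) r)).toReal + C (-s)) := by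
            refine Finset.sum_le_sum fun s _ => ?_
            refine (hβC (-s) _ (hB.inter measurableSet_Icc)).trans ?_
            rw [ENNReal.ofReal_add (mul_nonneg (hβ _) ENNReal.toReal_nonneg) (hC _),
              ENNReal.ofReal_mul (hβ _), ENNReal.ofReal_toReal hfin]
        _ = _ := by
            rw [← ENNReal.ofReal_sum_of_nonneg, Finset.sum_add_distrib, Finset.sum_mul]
            exact fun s _ => add_nonneg (mul_nonneg (hβ _) ENNReal.toReal_nonneg) (hC _)
    have h2 : m r ≤ bb * (μ (B ∩ Set.Icc (-r) r)).toReal + cc :=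
      ENNReal.toReal_le_of_le_ofReal (add_nonneg (mul_nonneg hbb ENNReal.toReal_nonneg)
        (Finset.sum_nonneg fun s _ => hC _)) h1
    have h3 : W x₀ / 4 * (μ (B ∩ Set.Icc (-r) r)).toReal ≤ ∫ t in Set.Icc (-r) r, W t ∂μ := by
      have := mul_meas_ge_le_integral_of_nonneg (μ := μ.restrict (Set.Icc (-r) r))
        (Eventually.of_forall h0) (hint r) (W x₀ / 4)
      rwa [Measure.real, Measure.restrict_apply hB] at this
    have h4 : (μ (B ∩ Set.Icc (-r) r)).toReal ≤
        4 / W x₀ * ∫ t in Set.Icc (-r) r, W t ∂μ := by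
      rw [div_mul_eq_mul_div, le_div_iff₀ hpos]
      linarith
    calc m r ≤ bb * (μ (B ∩ Set.Icc (-r) r)).toReal + cc := h2
      _ ≤ bb * (4 / W x₀ * ∫ t in Set.Icc (-r) r, W t ∂μ) + cc := by gcongr
      _ = _ := by ring
  have hmtop := tendsto_measure_Icc_toReal hμ1 hμ2
  have hlim : Tendsto (fun r => bb * (4 / W x₀) * (1 / m r * ∫ t in Set.Icc (-r) r, W t ∂μ)
      + cc / m r) atTop (𝓝 (bb * (4 / W x₀) * 0 + 0)) :=
    (herg.const_mul _).add (hmtop.const_div_atTop cc)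
  have hge : ∀ᶠ r in atTop, 1 ≤ bb * (4 / W x₀) * (1 / m r * ∫ t in Set.Icc (-r) r, W t ∂μ)
      + cc / m r := by
    filter_upwards [eventually_ge_atTop (2 * L), hmtop.eventually_gt_atTop 0] with r hr hmr
    change 0 < m r at hmr
    have := div_le_div_of_nonneg_right (hineq r hr) hmr.le
    rw [div_self hmr.ne'] at this
    refine this.trans_eq ?_
    field_simp
  have := ge_of_tendsto hlim hge
  norm_num at this

theorem aestronglyMeasurable_volume_of_measurable {E : Type*} [MetricSpace E] [MeasurableSpace E]
    [OpensMeasurableSpace E] {g : ℝ → E} (hg : Measurable g) :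
    AEStronglyMeasurable g (volume : Measure ℝ) :=
  (aestronglyMeasurable_of_measurable_real hg (volume : Measure ℝ).toFinite).mono_ac
    (absolutelyContinuous_toFinite _)

/-- Every nonempty metric space embeds isometrically into a space of bounded continuous
functions (Kuratowski). -/
theorem exists_isometry_boundedContinuousFunction (E : Type*) [MetricSpace E] [Nonempty E] :
    ∃ ι : E → BoundedContinuousFunction E ℝ, Isometry ι := by
  obtain ⟨e⟩ := ‹Nonempty E›
  refine ⟨fun x => BoundedContinuousFunction.ofNormedAddCommGroup
    (fun z => dist z x - dist z e) (by fun_prop) (dist x e) fun z => ?_, ?_⟩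
  · rw [Real.norm_eq_abs, dist_comm z x, dist_comm z e]
    exact abs_dist_sub_le x e z
  · refine Isometry.of_dist_eq fun x y => le_antisymm ?_ ?_
    · refine (BoundedContinuousFunction.dist_le dist_nonneg).2 fun z => ?_
      simpa [Real.dist_eq, dist_comm z] using abs_dist_sub_le x y z
    · refine le_trans ?_ (BoundedContinuousFunction.dist_coe_le_dist y)
      simp [dist_comm x y]

theorem intervalIntegrable_dist_rpow {E : Type*} [MetricSpace E] {p : ℝ} (hp : 1 ≤ p)
    {g h : ℝ → E} (hg : AEStronglyMeasurable g volume) (hh : AEStronglyMeasurable h volume)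
    (hgl : LocInt p g) (hhl : LocInt p h) (a b : ℝ) :
    IntervalIntegrable (fun t => dist (g t) (h t) ^ p) volume a b := by
  have hp0 : 0 ≤ p := by linarith
  set e := g 0
  refine (((hgl e a b).add (hhl e a b)).const_mul (2 ^ p)).mono_fun ?_ ?_
  · exact ((hg.dist hh).aemeasurable.pow_const p).aestronglyMeasurable.restrict
  · refine Eventually.of_forall fun t => ?_
    have hx := dist_nonneg (x := g t) (y := e)
    have hy := dist_nonneg (x := h t) (y := e)
    have hd := dist_triangle_right (g t) (h t) e
    have h1 := Real.rpow_nonneg hx p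
    have h2 := Real.rpow_nonneg hy p
    have h3 : (0:ℝ) ≤ 2 ^ p := by positivity
    beta_reduce
    rw [Real.norm_of_nonneg (by positivity), Real.norm_of_nonneg (by positivity)]
    rcases le_total (dist (g t) e) (dist (h t) e) with hle | hle
    · calc dist (g t) (h t) ^ p ≤ (2 * dist (h t) e) ^ p := by gcongr; linarith
        _ = 2 ^ p * dist (h t) e ^ p := Real.mul_rpow (by norm_num) hy
        _ ≤ _ := by gcongr; linarith
    · calc dist (g t) (h t) ^ p ≤ (2 * dist (g t) e) ^ p := by gcongr; linarith
        _ = 2 ^ p * dist (g t) e ^ p := Real.mul_rpow (by norm_num) hx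
        _ ≤ _ := by gcongr; linarith

theorem intervalIntegrable_of_rpow {p : ℝ} (hp : 1 ≤ p) {q : ℝ → ℝ} (hq0 : ∀ t, 0 ≤ q t)
    {a b : ℝ} (hqm : AEStronglyMeasurable q volume)
    (hq : IntervalIntegrable (fun t => q t ^ p) volume a b) :
    IntervalIntegrable q volume a b := by
  refine ((intervalIntegrable_const (c := (1:ℝ))).add hq).mono_fun hqm.restrict ?_
  refine Eventually.of_forall fun t => ?_
  have h1 := Real.rpow_nonneg (hq0 t) p
  beta_reduce
  rw [Real.norm_of_nonneg (hq0 t), Real.norm_of_nonneg (by positivity)]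
  rcases le_total (q t) 1 with h | h
  · linarith
  · linarith [Real.self_le_rpow_of_one_le h hp]

theorem integral_le_rpow_integral_rpow {p : ℝ} (hp : 1 ≤ p) {q : ℝ → ℝ} (hq0 : ∀ t, 0 ≤ q t)
    {x : ℝ} (hqm : AEStronglyMeasurable q volume)
    (hq : IntervalIntegrable (fun t => q t ^ p) volume x (x + 1)) :
    ∫ t in x..(x + 1), q t ≤ (∫ t in x..(x + 1), q t ^ p) ^ (1 / p) := by
  have hp0 : 0 < p := by linarith
  have hx : x ≤ x + 1 := by linarith
  have hq1 := intervalIntegrable_of_rpow hp hq0 hqm hq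
  rw [intervalIntegrable_iff_integrableOn_Ioc_of_le hx] at hq hq1
  rw [intervalIntegral.integral_of_le hx, intervalIntegral.integral_of_le hx]
  have : IsProbabilityMeasure (volume.restrict (Set.Ioc x (x + 1))) := ⟨by simp⟩
  have key := (convexOn_rpow hp).map_integral_le
    (Real.continuous_rpow_const hp0.le).continuousOn isClosed_Ici
    (Eventually.of_forall fun t => hq0 t) hq1 hq
  rw [← Real.rpow_le_rpow_iff (integral_nonneg hq0)
    (Real.rpow_nonneg (integral_nonneg fun t => Real.rpow_nonneg (hq0 t) p) _) hp0,
    ← Real.rpow_mul (integral_nonneg fun t => Real.rpow_nonneg (hq0 t) p),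
    one_div_mul_cancel hp0.ne', Real.rpow_one]
  exact key

theorem continuous_integral_window {q : ℝ → ℝ} (hq : ∀ a b, IntervalIntegrable q volume a b) :
    Continuous fun t => ∫ s in (0:ℝ)..1, q (t + s) := by
  have h : (fun t => ∫ s in (0:ℝ)..1, q (t + s)) =
      fun t => (∫ s in (0:ℝ)..(t + 1), q s) - ∫ s in (0:ℝ)..t, q s := by
    ext t
    rw [intervalIntegral.integral_comp_add_left, add_zero,
      intervalIntegral.integral_interval_sub_left (hq _ _) (hq _ _)]
  rw [h]
  have hc := intervalIntegral.continuous_primitive hq 0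
  exact (hc.comp (continuous_add_const 1)).sub hc

section BohrTransform

variable {F : Type*} [NormedAddCommGroup F] {G H : ℝ → F}

theorem integrable_window (hG : ∀ a b, IntervalIntegrable G volume a b) (x : ℝ) :
    Integrable (fun s => G (x + s)) (volume.restrict (Set.Ioc (0:ℝ) 1)) := by
  have := (hG (x + 0) (x + 1)).comp_add_left x
  rw [add_sub_cancel_left, add_sub_cancel_left,
    intervalIntegrable_iff_integrableOn_Ioc_of_le zero_le_one] at this
  exact this

/-- The Bohr transform: the curve of unit windows of a locally integrable function. -/
noncomputable def bohrTransform (hG : ∀ a b, IntervalIntegrable G volume a b) (x : ℝ) :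
    Lp F 1 (volume.restrict (Set.Ioc (0:ℝ) 1)) :=
  (integrable_window hG x).toL1

theorem dist_bohrTransform (hG : ∀ a b, IntervalIntegrable G volume a b)
    (hH : ∀ a b, IntervalIntegrable H volume a b) (x y : ℝ) :
    dist (bohrTransform hG x) (bohrTransform hH y) =
      ∫ s in (0:ℝ)..1, ‖G (x + s) - H (y + s)‖ := by
  rw [bohrTransform, bohrTransform, dist_eq_norm, ← Integrable.toL1_sub, L1.norm_of_fun_eq_integral_norm,
    intervalIntegral.integral_of_le zero_le_one]
  rfl

theorem continuous_bohrTransform [NormedSpace ℝ F]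
    (hG : ∀ a b, IntervalIntegrable G volume a b) : Continuous (bohrTransform hG) := by
  rw [Metric.continuous_iff]
  intro x ε hε
  set K := Set.Ioc (x - 2) (x + 3) with hK
  have hGK : Integrable (K.indicator G) := by
    rw [integrable_indicator_iff measurableSet_Ioc,
      ← intervalIntegrable_iff_integrableOn_Ioc_of_le (by linarith)]
    exact hG _ _
  obtain ⟨φ, hφs, hφ, hφc, hφi⟩ :=
    hGK.exists_hasCompactSupport_integral_sub_le (ε := ε / 4) (by positivity)
  obtain ⟨δ, hδ, hδφ⟩ := Metric.uniformContinuous_iff.1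
    (hφs.uniformContinuous_of_continuous hφc) (ε / 4) (by positivity)
  have happ : ∀ y, |y - x| < 1 → ∫ s in (0:ℝ)..1, ‖G (y + s) - φ (y + s)‖ ≤ ε / 4 := by
    intro y hy
    rw [abs_lt] at hy
    refine le_trans ?_ hφ
    rw [intervalIntegral.integral_comp_add_left (fun t => ‖G t - φ t‖),
      intervalIntegral.integral_of_le (by linarith)]
    calc ∫ t in Set.Ioc (y + 0) (y + 1), ‖G t - φ t‖
        = ∫ t in Set.Ioc (y + 0) (y + 1), ‖K.indicator G t - φ t‖ := by
          refine setIntegral_congr_fun measurableSet_Ioc fun t ht => ?_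
          have : t ∈ K := ⟨by linarith [ht.1], by linarith [ht.2]⟩
          simp [this]
      _ ≤ _ := setIntegral_le_integral (hGK.sub hφi).norm
          (Eventually.of_forall fun _ => norm_nonneg _)
  have hφl : ∀ a b, IntervalIntegrable φ volume a b := fun a b => hφc.intervalIntegrable a b
  refine ⟨min δ 1, by positivity, fun y hy => ?_⟩
  have hy1 : |y - x| < 1 := hy.trans_le (min_le_right _ _)
  have h1 := happ y hy1
  have h2 := happ x (by simp)
  have h3 : dist (bohrTransform hφl y) (bohrTransform hφl x) ≤ ε / 4 := by
    rw [dist_bohrTransform]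
    have : ∫ s in (0:ℝ)..1, ‖φ (y + s) - φ (x + s)‖ ≤ ∫ s in (0:ℝ)..1, ε / 4 := by
      refine intervalIntegral.integral_mono_on zero_le_one
        (Continuous.intervalIntegrable (by fun_prop) _ _) (by simp) fun s _ => ?_
      rw [← dist_eq_norm]
      refine (hδφ ?_).le
      simpa using hy.trans_le (min_le_left _ _)
    simpa using this
  rw [← dist_bohrTransform hG hφl] at h1 h2
  have := dist_triangle4_right (bohrTransform hG y) (bohrTransform hG x)
    (bohrTransform hφl y) (bohrTransform hφl x)
  linarith

end BohrTransform

theorem LocInt.comp_add_right {E : Type*} [PseudoMetricSpace E] {p : ℝ} {g : ℝ → E}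
    (hg : LocInt p g) (τ : ℝ) : LocInt p fun t => g (t + τ) := fun e a b => by
  simpa using (hg e (a + τ) (b + τ)).comp_add_right τ

theorem SpAP.bohrAP_bohrTransform {E F : Type*} [MetricSpace E] [MeasurableSpace E]
    [OpensMeasurableSpace E] [NormedAddCommGroup F] {p : ℝ} (hp : 1 ≤ p) {g : ℝ → E}
    (hgm : Measurable g) (hgl : LocInt p g) (hg : SpAP p g) {ι : E → F} (hι : Isometry ι)
    (hG : ∀ a b, IntervalIntegrable (fun t => ι (g t)) volume a b) :
    BohrAP (bohrTransform hG) := by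
  intro ε hε
  refine (hg ε hε).mono fun τ hτ x => ?_
  have hm := aestronglyMeasurable_volume_of_measurable hgm
  have hmτ := aestronglyMeasurable_volume_of_measurable (hgm.comp (measurable_add_const τ))
  calc dist (bohrTransform hG (x + τ)) (bohrTransform hG x)
      = ∫ s in (0:ℝ)..1, dist (g (x + s + τ)) (g (x + s)) := by
        rw [dist_bohrTransform]
        simp only [← dist_eq_norm, hι.dist_eq, add_right_comm x τ]
    _ = ∫ t in x..(x + 1), dist (g (t + τ)) (g t) := by
        rw [intervalIntegral.integral_comp_add_left (fun t => dist (g (t + τ)) (g t)), add_zero]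
    _ ≤ (∫ t in x..(x + 1), dist (g (t + τ)) (g t) ^ p) ^ (1 / p) :=
        integral_le_rpow_integral_rpow hp (fun _ => dist_nonneg) (hmτ.dist hm)
          (intervalIntegrable_dist_rpow hp hmτ hm (hgl.comp_add_right τ) hgl _ _)
    _ ≤ ε := hτ x

theorem LocInt.intervalIntegrable_comp_isometry {E F : Type*} [MetricSpace E]
    [NormedAddCommGroup F] {p : ℝ} (hp : 1 ≤ p) {g : ℝ → E} (hgm : AEStronglyMeasurable g volume)
    (hgl : LocInt p g) {ι : E → F} (hι : Isometry ι) (a b : ℝ) :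
    IntervalIntegrable (fun t => ι (g t)) volume a b := by
  set e := g 0
  have h := intervalIntegrable_of_rpow hp (fun t => dist_nonneg)
    (hgm.dist aestronglyMeasurable_const) (hgl e a b)
  refine (h.add (intervalIntegrable_const (c := ‖ι e‖))).mono_fun
    (hι.continuous.comp_aestronglyMeasurable hgm).restrict (Eventually.of_forall fun t => ?_)
  beta_reduce
  rw [Real.norm_of_nonneg (by positivity), ← hι.dist_eq, dist_eq_norm]
  exact norm_le_norm_sub_add _ _

theorem MuErgodic.of_le_add {μ : Measure ℝ} (hμ : ∀ a b : ℝ, μ (Set.Icc a b) < ⊤)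
    {W φ ψ : ℝ → ℝ} (hφ : MuErgodic μ φ) (hψ : MuErgodic μ ψ) (hWc : Continuous W)
    (hφc : Continuous φ) (hψc : Continuous ψ) (h0 : ∀ x, 0 ≤ W x)
    (hle : ∀ x, W x ≤ φ x + ψ x) : MuErgodic μ W := by
  have : IsLocallyFiniteMeasure μ := ⟨fun x => ⟨Set.Icc (x - 1) (x + 1),
    Icc_mem_nhds (by linarith) (by linarith), hμ _ _⟩⟩
  have hint : ∀ {f : ℝ → ℝ}, Continuous f → ∀ r, IntegrableOn f (Set.Icc (-r) r) μ :=
    fun hf r => hf.continuousOn.integrableOn_compact isCompact_Icc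
  refine squeeze_zero (fun r => ?_) (fun r => ?_) (by simpa only [add_zero] using hφ.add hψ)
  · exact mul_nonneg (by positivity) (integral_nonneg h0)
  · rw [← mul_add, ← integral_add (hint hφc r) (hint hψc r)]
    exact mul_le_mul_of_nonneg_left
      (integral_mono (hint hWc r) ((hint hφc r).add (hint hψc r)) hle)
      (one_div_nonneg.2 ENNReal.toReal_nonneg)

/-- uniqueness of the almost periodic component: if `g₁` and `g₂` are both
`S^p`-almost periodic and, for each `i`, `t ↦ (∫_0^1 d(f(t+s), g_i(t+s))^p ds)^{1/p}` is
`μ`-ergodic (with `μ` satisfying condition (H)), then `g₁ = g₂` Lebesgue-almost everywhere. -/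
theorem stmt12 {E : Type*} [MetricSpace E] [CompleteSpace E]
    [MeasurableSpace E] [OpensMeasurableSpace E]
    (μ : Measure ℝ) (hμ1 : μ Set.univ = ⊤)
    (hμ2 : ∀ a b : ℝ, μ (Set.Icc a b) < ⊤) (hμH : CondH μ)
    (p : ℝ) (hp : 1 ≤ p)
    (f g₁ g₂ : ℝ → E)
    (hfm : Measurable f) (hfl : LocInt p f)
    (hg₁m : Measurable g₁) (hg₁l : LocInt p g₁) (hg₁ap : SpAP p g₁)
    (hg₂m : Measurable g₂) (hg₂l : LocInt p g₂) (hg₂ap : SpAP p g₂)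
    (herg₁ : MuErgodic μ (fun t =>
      (∫ s in (0:ℝ)..1, dist (f (t + s)) (g₁ (t + s)) ^ p) ^ (1 / p)))
    (herg₂ : MuErgodic μ (fun t =>
      (∫ s in (0:ℝ)..1, dist (f (t + s)) (g₂ (t + s)) ^ p) ^ (1 / p))) :
    g₁ =ᵐ[volume] g₂ := by
  have hp0 : 0 ≤ 1 / p := one_div_nonneg.2 (by linarith)
  have hf := aestronglyMeasurable_volume_of_measurable hfm
  have hg₁ := aestronglyMeasurable_volume_of_measurable hg₁m
  have hg₂ := aestronglyMeasurable_volume_of_measurable hg₂m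
  have : Nonempty E := ⟨f 0⟩
  obtain ⟨ι, hι⟩ := exists_isometry_boundedContinuousFunction E
  have hG₁ := hg₁l.intervalIntegrable_comp_isometry hp hg₁ hι
  have hG₂ := hg₂l.intervalIntegrable_comp_isometry hp hg₂ hι
  have hap := (hg₁ap.bohrAP_bohrTransform hp hg₁m hg₁l hι hG₁).dist
    (hg₂ap.bohrAP_bohrTransform hp hg₂m hg₂l hι hG₂) (continuous_bohrTransform hG₂)
  have hc := (continuous_bohrTransform hG₁).dist (continuous_bohrTransform hG₂)
  have hd₁ := intervalIntegrable_dist_rpow hp hf hg₁ hfl hg₁l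
  have hd₂ := intervalIntegrable_dist_rpow hp hf hg₂ hfl hg₂l
  have hi₁ := fun a b => intervalIntegrable_of_rpow hp (fun _ => dist_nonneg) (hf.dist hg₁) (hd₁ a b)
  have hi₂ := fun a b => intervalIntegrable_of_rpow hp (fun _ => dist_nonneg) (hf.dist hg₂) (hd₂ a b)
  have hi := fun a b => intervalIntegrable_of_rpow hp (fun _ => dist_nonneg) (hg₁.dist hg₂)
    (intervalIntegrable_dist_rpow hp hg₁ hg₂ hg₁l hg₂l a b)
  have hW : ∀ x, dist (bohrTransform hG₁ x) (bohrTransform hG₂ x) =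
      ∫ t in x..(x + 1), dist (g₁ t) (g₂ t) := by
    intro x
    rw [dist_bohrTransform, intervalIntegral.integral_comp_add_left
      (fun t => ‖ι (g₁ t) - ι (g₂ t)‖), add_zero]
    simp only [← dist_eq_norm, hι.dist_eq]
  have herg : MuErgodic μ fun x => dist (bohrTransform hG₁ x) (bohrTransform hG₂ x) := by
    refine herg₁.of_le_add hμ2 herg₂ hc
      ((continuous_integral_window fun a b => hd₁ a b).rpow_const fun _ => Or.inr hp0)
      ((continuous_integral_window fun a b => hd₂ a b).rpow_const fun _ => Or.inr hp0)
      (fun _ => dist_nonneg) fun x => ?_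
    rw [hW, intervalIntegral.integral_comp_add_left (fun t => dist (f t) (g₁ t) ^ p),
      intervalIntegral.integral_comp_add_left (fun t => dist (f t) (g₂ t) ^ p), add_zero]
    calc ∫ t in x..(x + 1), dist (g₁ t) (g₂ t)
        ≤ ∫ t in x..(x + 1), (dist (f t) (g₁ t) + dist (f t) (g₂ t)) :=
          intervalIntegral.integral_mono_on (by linarith) (hi _ _) ((hi₁ _ _).add (hi₂ _ _))
            fun t _ => dist_triangle_left _ _ _
      _ = (∫ t in x..(x + 1), dist (f t) (g₁ t)) + ∫ t in x..(x + 1), dist (f t) (g₂ t) :=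
          intervalIntegral.integral_add (hi₁ _ _) (hi₂ _ _)
      _ ≤ _ := add_le_add
          (integral_le_rpow_integral_rpow hp (fun _ => dist_nonneg) (hf.dist hg₁) (hd₁ _ _))
          (integral_le_rpow_integral_rpow hp (fun _ => dist_nonneg) (hf.dist hg₂) (hd₂ _ _))
  have hzero := hap.eq_zero_of_muErgodic hμ1 hμ2 hμH hc (fun _ => dist_nonneg) herg
  have hae : ∀ᵐ t ∂volume.restrict (⋃ n : ℤ, Set.Ioc (n : ℝ) (n + 1)), g₁ t = g₂ t := by
    rw [ae_restrict_iUnion_iff]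
    intro n
    have h := (hW n).symm.trans (hzero n)
    rw [intervalIntegral.integral_of_le (by linarith),
      setIntegral_eq_zero_iff_of_nonneg_ae (Eventually.of_forall fun _ => dist_nonneg)
        ((intervalIntegrable_iff_integrableOn_Ioc_of_le (by linarith)).1 (hi _ _))] at h
    filter_upwards [h] with t ht using dist_eq_zero.1 ht
  rwa [iUnion_Ioc_intCast, Measure.restrict_univ] at hae
end

section
/- Let 𝕏 be a Banach space and let f : ℝ → 𝕏 be S⁰-almost periodic (Stepanov almost periodic in Lebesgue measure). Then for every ε > 0 there exist a Lebesgue-measurable set T_ε ⊆ ℝ whose indicator function 1_{T_ε} : ℝ → ℝ is S¹-almost periodic, and a compact set K_ε ⊆ 𝕏, such that κ(ℝ \ T_ε) < ε and f(t) ∈ K_ε for all t ∈ T_ε, where κ(A) = sup_{ξ∈ℝ} Leb([ξ, ξ+1] ∩ A) for a measurable set A ⊆ ℝ. -/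
open MeasureTheory Filter Topology

/-- `f` is `S⁰`-almost periodic (Stepanov almost periodic in Lebesgue measure): for all
`ε, δ > 0`, the set of `τ` with `sup_ξ Leb{t ∈ [ξ,ξ+1] : d(f(t+τ), f(t)) ≥ ε} < δ` is
relatively dense. -/
def S0AP {E : Type*} [PseudoMetricSpace E] (f : ℝ → E) : Prop :=
  ∀ ε > 0, ∀ δ > (0:ℝ), RelDense {τ : ℝ |
    (⨆ ξ : ℝ, volume {t ∈ Set.Icc ξ (ξ + 1) | ε ≤ dist (f (t + τ)) (f t)})
      < ENNReal.ofReal δ}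

/-- An open set with uncountable image under a continuous map contains two small open sets with
uncountable images, whose closures have disjoint images. -/
lemma exists_open_splitting {P : Type*} [MetricSpace P] [SecondCountableTopology P] {g : P → ℝ}
    (hg : Continuous g) {U : Set P} (hU : IsOpen U) (hgU : ¬ (g '' U).Countable) {ε : ℝ}
    (hε : 0 < ε) :
    ∃ U₀ U₁ : Set P,
      (IsOpen U₀ ∧ ¬ (g '' U₀).Countable ∧ closure U₀ ⊆ U ∧
        Metric.ediam (closure U₀) ≤ ENNReal.ofReal ε) ∧
      (IsOpen U₁ ∧ ¬ (g '' U₁).Countable ∧ closure U₁ ⊆ U ∧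
        Metric.ediam (closure U₁) ≤ ENNReal.ofReal ε) ∧
      Disjoint (g '' closure U₀) (g '' closure U₁) := by
  set S : Set P := {x ∈ U | ∃ W ∈ 𝓝 x, (g '' W).Countable} with hS
  have hgS : (g '' S).Countable := by
    have hW : ∀ x : P, ∃ W : Set P, x ∈ S → W ∈ 𝓝 x ∧ (g '' W).Countable := by
      intro x
      by_cases hx : x ∈ S
      · obtain ⟨W, hW⟩ := hx.2
        exact ⟨W, fun _ => hW⟩
      · exact ⟨∅, fun h => absurd h hx⟩
    choose W hW using hW
    obtain ⟨t, htS, htc, ht⟩ := TopologicalSpace.countable_cover_nhdsWithin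
      (f := W) (s := S) fun x hx => mem_nhdsWithin_of_mem_nhds (hW x hx).1
    refine Set.Countable.mono (Set.image_mono ht) ?_
    rw [Set.image_iUnion₂]
    exact htc.biUnion fun x hx => (hW x (htS hx)).2
  have hnt : ¬ (g '' (U \ S)).Subsingleton := by
    intro h
    refine hgU ((h.countable.union hgS).mono ?_)
    rw [← Set.image_union]
    exact Set.image_mono fun x hx => by by_cases h : x ∈ S <;> simp [h, hx]
  obtain ⟨_, ⟨x, hx, rfl⟩, _, ⟨y, hy, rfl⟩, hxy⟩ := Set.not_subsingleton_iff.1 hnt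
  have key : ∀ z ∈ U \ S, ∀ δ > 0, ∃ V : Set P, IsOpen V ∧ ¬ (g '' V).Countable ∧
      closure V ⊆ U ∧ Metric.ediam (closure V) ≤ ENNReal.ofReal ε ∧
      g '' closure V ⊆ Metric.closedBall (g z) δ := by
    intro z hz δ hδ
    have hN : U ∩ g ⁻¹' Metric.closedBall (g z) δ ∈ 𝓝 z :=
      inter_mem (hU.mem_nhds hz.1) (hg.continuousAt (Metric.closedBall_mem_nhds _ hδ))
    obtain ⟨r, hr, hrN⟩ := Metric.nhds_basis_closedBall.mem_iff.1 hN
    have hm : 0 < min r (ε / 2) := lt_min hr (by positivity)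
    have hcl : closure (Metric.ball z (min r (ε / 2))) ⊆ Metric.closedBall z (min r (ε / 2)) :=
      Metric.closure_ball_subset_closedBall
    have hcl' := hcl.trans ((Metric.closedBall_subset_closedBall (min_le_left _ _)).trans hrN)
    refine ⟨Metric.ball z (min r (ε / 2)), Metric.isOpen_ball, ?_,
      hcl'.trans Set.inter_subset_left, ?_, ?_⟩
    · intro hc
      exact hz.2 ⟨hz.1, _, Metric.ball_mem_nhds _ hm, hc⟩
    · refine Metric.ediam_le fun a ha b hb => ?_
      rw [edist_dist]
      apply ENNReal.ofReal_le_ofReal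
      have h1 := Metric.mem_closedBall.1 (hcl ha)
      have h2 := Metric.mem_closedBall'.1 (hcl hb)
      have h3 := min_le_right r (ε / 2)
      linarith [dist_triangle a z b]
    · rw [Set.image_subset_iff]
      exact hcl'.trans Set.inter_subset_right
  have hd : 0 < dist (g x) (g y) := dist_pos.2 hxy
  obtain ⟨U₀, h01, h02, h03, h04, h05⟩ := key x hx (dist (g x) (g y) / 3) (by positivity)
  obtain ⟨U₁, h11, h12, h13, h14, h15⟩ := key y hy (dist (g x) (g y) / 3) (by positivity)
  refine ⟨U₀, U₁, ⟨h01, h02, h03, h04⟩, ⟨h11, h12, h13, h14⟩, ?_⟩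
  exact (Metric.closedBall_disjoint_closedBall (by linarith)).mono h05 h15

/-- A continuous real function on a Polish space with uncountable range takes continuum many
values. -/
lemma exists_cantor_injection_range {P : Type*} [TopologicalSpace P] [PolishSpace P] {g : P → ℝ}
    (hg : Continuous g) (hr : ¬ (Set.range g).Countable) :
    ∃ φ : (ℕ → Bool) → ℝ, Function.Injective φ ∧ Set.range φ ⊆ Set.range g := by
  let := TopologicalSpace.upgradeIsCompletelyMetrizable P
  let Q := {U : Set P // IsOpen U ∧ ¬ (g '' U).Countable}
  choose C0 C1 h0 h1 hdisj using
    fun (U : Q) (n : ℕ) => exists_open_splitting hg U.2.1 U.2.2 (ε := 1 / ((n : ℝ) + 1))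
      (by positivity)
  let DP : List Bool → Q := fun l => by
    induction l with
    | nil => exact ⟨Set.univ, isOpen_univ, by simpa using hr⟩
    | cons a l ih =>
      cases a
      · exact ⟨C0 ih l.length, (h0 _ _).1, (h0 _ _).2.1⟩
      · exact ⟨C1 ih l.length, (h1 _ _).1, (h1 _ _).2.1⟩
  let D : List Bool → Set P := fun l => closure (DP l).1
  have hanti : CantorScheme.ClosureAntitone D := by
    refine CantorScheme.Antitone.closureAntitone ?_ fun l => isClosed_closure
    intro l a
    cases a
    · exact (h0 _ _).2.2.1.trans subset_closure
    · exact (h1 _ _).2.2.1.trans subset_closure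
  have hdiam : CantorScheme.VanishingDiam D := by
    intro x
    have hu : Tendsto (fun n : ℕ => ENNReal.ofReal (1 / ((n : ℝ) + 1))) atTop (𝓝 0) := by
      simpa using ENNReal.tendsto_ofReal (tendsto_one_div_add_atTop_nhds_zero_nat (𝕜 := ℝ))
    rw [← tendsto_add_atTop_iff_nat 1]
    refine tendsto_of_tendsto_of_tendsto_of_le_of_le tendsto_const_nhds hu
      (fun _ => zero_le) fun n => ?_
    dsimp only
    rw [PiNat.res_succ]
    cases x n
    · exact (h0 (DP (PiNat.res x n)) (PiNat.res x n).length).2.2.2.trans_eq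
        (by rw [PiNat.res_length])
    · exact (h1 (DP (PiNat.res x n)) (PiNat.res x n).length).2.2.2.trans_eq
        (by rw [PiNat.res_length])
  have hne : ∀ l, (D l).Nonempty := fun l => by
    by_contra h
    rw [Set.not_nonempty_iff_eq_empty, closure_empty_iff] at h
    exact (DP l).2.2 (by rw [h]; simp)
  have huniv := hanti.map_of_vanishingDiam hdiam hne
  let A : List Bool → Set ℝ := fun l => g '' D l
  have hA : CantorScheme.Disjoint A := by
    rintro l (a | a) (b | b) hab <;> try contradiction
    · exact hdisj _ _
    · exact (hdisj _ _).symm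
  have hdom : ∀ x : ℕ → Bool, x ∈ (CantorScheme.inducedMap A).1 := fun x => by
    have hx : x ∈ (CantorScheme.inducedMap D).1 := huniv ▸ Set.mem_univ x
    refine ⟨g ((CantorScheme.inducedMap D).2 ⟨x, hx⟩), Set.mem_iInter.2 fun n => ?_⟩
    exact Set.mem_image_of_mem _ (CantorScheme.map_mem (A := D) ⟨x, hx⟩ n)
  refine ⟨fun x => (CantorScheme.inducedMap A).2 ⟨x, hdom x⟩, ?_, ?_⟩
  · intro x y hxy
    simpa only [← Subtype.val_inj] using hA.map_injective hxy
  · rintro _ ⟨x, rfl⟩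
    exact Set.image_subset_range _ _ (CantorScheme.map_mem (A := A) ⟨x, hdom x⟩ 0)

/-- A real function, all of whose preimages are Borel, has countable range. -/
lemma countable_range_of_measurableSet_preimage {g : ℝ → ℝ}
    (hg : ∀ A : Set ℝ, MeasurableSet (g ⁻¹' A)) : (Set.range g).Countable := by
  by_contra hr
  have hgm : Measurable g := fun A _ => hg A
  obtain ⟨φ, hφ, hφr⟩ : ∃ φ : (ℕ → Bool) → ℝ, Function.Injective φ ∧
      Set.range φ ⊆ Set.range g := by
    obtain ⟨t', -, hc, hP⟩ := hgm.exists_continuous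
    exact @exists_cantor_injection_range ℝ t' hP g hc hr
  have hinj : Function.Injective (fun A : Set (ℕ → Bool) =>
      (⟨g ⁻¹' (φ '' A), hg _⟩ : {t : Set ℝ | MeasurableSet t})) := by
    intro A B hAB
    have h1 : g ⁻¹' (φ '' A) = g ⁻¹' (φ '' B) := congrArg Subtype.val hAB
    have hsub : ∀ C : Set (ℕ → Bool), φ '' C ⊆ Set.range g := fun C =>
      (Set.image_subset_range _ _).trans hφr
    rw [Set.preimage_eq_preimage' (hsub A) (hsub B)] at h1
    exact hφ.image_injective h1
  have h1 := Cardinal.mk_le_of_injective hinj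
  have h2 : Cardinal.mk {t : Set ℝ | MeasurableSet t} ≤ Cardinal.continuum := by
    obtain ⟨b, hb, hb'⟩ := MeasurableSpace.CountablyGenerated.isCountablyGenerated (α := ℝ)
    rw [hb']
    exact MeasurableSpace.cardinal_measurableSet_le_continuum
      ((Cardinal.mk_le_aleph0_iff.2 hb.to_subtype).trans Cardinal.aleph0_le_continuum)
  have h3 := h1.trans h2
  rw [Cardinal.mk_set] at h3
  have h4 : Cardinal.mk (ℕ → Bool) = Cardinal.continuum := by simp
  rw [h4] at h3
  exact absurd h3 (not_le.2 (Cardinal.cantor _))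

/-- A Borel function from the real line to a metric space has separable range. -/
lemma isSeparable_range_of_measurable {X : Type*} [MetricSpace X] [MeasurableSpace X]
    [BorelSpace X] {f : ℝ → X} (hf : Measurable f) :
    TopologicalSpace.IsSeparable (Set.range f) := by
  have hcount : ∀ r > 0, ∀ D : Set X, D ⊆ Set.range f →
      D.Pairwise (fun x y => r ≤ dist x y) → D.Countable := by
    intro r hr D hDf hD
    have hclosed : ∀ A ⊆ D, IsClosed A := fun A hA =>
      Metric.isClosed_of_pairwise_le_dist hr (hD.mono hA)
    choose! s hs using fun x : X => fun hx : x ∈ D => hDf hx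
    classical
    let H : X → ℝ := fun x => if x ∈ D then s x else 0
    have hH : ∀ A : Set ℝ, MeasurableSet (H ⁻¹' A) := by
      intro A
      have h1 : H ⁻¹' A = (D ∩ s ⁻¹' A) ∪ (Dᶜ ∩ {x | (0 : ℝ) ∈ A}) := by
        ext x
        by_cases hx : x ∈ D <;> simp [H, hx]
      rw [h1]
      exact (hclosed _ Set.inter_subset_left).measurableSet.union
        ((hclosed D le_rfl).measurableSet.compl.inter (MeasurableSet.const _))
    have hc := countable_range_of_measurableSet_preimage (g := H ∘ f)
      fun A => by rw [Set.preimage_comp]; exact hf (hH A)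
    have hDinj : Set.InjOn H D := by
      intro x hx y hy hxy
      simp only [H, hx, hy, if_true] at hxy
      rw [← hs x hx, ← hs y hy, hxy]
    refine Set.countable_of_injective_of_countable_image hDinj (hc.mono ?_)
    rintro _ ⟨x, hx, rfl⟩
    obtain ⟨t, rfl⟩ := hDf hx
    exact ⟨t, rfl⟩
  have hcover : ∀ ε > 0, ∃ t : Set X, t.Countable ∧
      Set.range f ⊆ ⋃ x ∈ t, Metric.closedEBall x ε := by
    intro ε hε
    obtain ⟨r, hr, hrε⟩ : ∃ r : ℝ, 0 < r ∧ ENNReal.ofReal r ≤ ε := by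
      rcases eq_or_ne ε ⊤ with rfl | h
      · exact ⟨1, one_pos, le_top⟩
      · exact ⟨ε.toReal, ENNReal.toReal_pos hε.ne' h, by rw [ENNReal.ofReal_toReal h]⟩
    obtain ⟨D, hD⟩ := zorn_subset
      {D : Set X | D ⊆ Set.range f ∧ D.Pairwise fun x y => r ≤ dist x y} (by
        intro c hc hchain
        refine ⟨⋃₀ c, ⟨Set.sUnion_subset fun s hs => (hc hs).1, ?_⟩,
          fun s hs => Set.subset_sUnion_of_mem hs⟩
        exact (Set.pairwise_sUnion hchain.directedOn).2 fun s hs => (hc hs).2)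
    refine ⟨D, hcount r hr D hD.1.1 hD.1.2, fun x hx => ?_⟩
    rw [Set.mem_iUnion₂]
    by_contra! hcon
    have hfar : ∀ y ∈ D, r ≤ dist x y := by
      intro y hy
      by_contra! hlt
      refine hcon y hy ?_
      rw [Metric.mem_closedEBall, edist_dist]
      exact (ENNReal.ofReal_le_ofReal hlt.le).trans hrε
    have hxD : x ∈ D := by
      have hins : insert x D ∈ {D : Set X | D ⊆ Set.range f ∧
          D.Pairwise fun x y => r ≤ dist x y} := by
        refine ⟨Set.insert_subset hx hD.1.1, ?_⟩
        exact Set.pairwise_insert.2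
          ⟨hD.1.2, fun y hy _ => ⟨hfar y hy, dist_comm x y ▸ hfar y hy⟩⟩
      exact hD.2 hins (Set.subset_insert _ _) (Set.mem_insert _ _)
    have := hfar x hxD
    rw [dist_self] at this
    linarith
  obtain ⟨t, -, htc, ht⟩ := EMetric.subset_countable_closure_of_almost_dense_set _ hcover
  exact ⟨t, htc, ht⟩

/-- A pseudodistance (for strongly measurable functions) inducing convergence in measure. -/
noncomputable def mdist {α X : Type*} [MeasurableSpace α] [PseudoEMetricSpace X] (μ : Measure α)
    (f g : α → X) : ENNReal :=
  ∫⁻ t, min 1 (edist (f t) (g t)) ∂μ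

section mdist

variable {α X : Type*} [MeasurableSpace α] [PseudoMetricSpace X] {μ : Measure α} {f g h : α → X}

lemma mdist_comm : mdist μ f g = mdist μ g f := by
  simp only [mdist, edist_comm]

lemma mdist_mono_measure {ν : Measure α} (hμ : μ ≤ ν) : mdist μ f g ≤ mdist ν f g :=
  lintegral_mono' hμ le_rfl

lemma measurable_min_one_edist (hf : StronglyMeasurable f) (hg : StronglyMeasurable g) :
    Measurable fun t => min 1 (edist (f t) (g t)) :=
  measurable_const.min (hf.edist hg).measurable

lemma mdist_triangle (hf : StronglyMeasurable f) (hg : StronglyMeasurable g) :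
    mdist μ f h ≤ mdist μ f g + mdist μ g h := by
  unfold mdist
  rw [← lintegral_add_left (measurable_min_one_edist hf hg)]
  refine lintegral_mono fun t => ?_
  rcases le_total 1 (edist (f t) (g t)) with h1 | h1
  · rw [min_eq_left h1]
    exact (min_le_left _ _).trans le_self_add
  rcases le_total 1 (edist (g t) (h t)) with h2 | h2
  · rw [min_eq_left h2]
    exact (min_le_left _ _).trans le_add_self
  · rw [min_eq_right h1, min_eq_right h2]
    exact (min_le_right _ _).trans (edist_triangle _ _ _)

lemma mdist_le_measure_univ : mdist μ f g ≤ μ Set.univ := by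
  refine (lintegral_mono fun t => min_le_left _ _).trans ?_
  simp

/-- Markov's inequality for `mdist`. -/
lemma ofReal_mul_measure_le_mdist (hf : StronglyMeasurable f) (hg : StronglyMeasurable g) {ε : ℝ}
    (hε : ε ≤ 1) : ENNReal.ofReal ε * μ {t | ε ≤ dist (f t) (g t)} ≤ mdist μ f g := by
  refine le_trans (mul_le_mul_right (measure_mono fun t ht => ?_) _)
    (mul_meas_ge_le_lintegral (measurable_min_one_edist hf hg) (ENNReal.ofReal ε))
  simp only [Set.mem_ofPred_eq] at ht ⊢
  rw [edist_dist]
  exact le_min (by simpa using hε) (ENNReal.ofReal_le_ofReal ht)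

lemma mdist_le_add (hf : StronglyMeasurable f) (hg : StronglyMeasurable g) (ε : ℝ) :
    mdist μ f g ≤ ENNReal.ofReal ε * μ Set.univ + μ {t | ε ≤ dist (f t) (g t)} := by
  have hm : MeasurableSet {t | ε ≤ dist (f t) (g t)} :=
    measurableSet_le measurable_const (hf.dist hg).measurable
  rw [← lintegral_const, ← lintegral_indicator_one hm,
    ← lintegral_add_left measurable_const]
  refine lintegral_mono fun t => ?_
  by_cases ht : ε ≤ dist (f t) (g t)
  · rw [Set.indicator_of_mem (by exact ht)]
    exact (min_le_left _ _).trans le_add_self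
  · rw [Set.indicator_of_notMem (by exact ht), edist_dist, add_zero]
    exact (min_le_right _ _).trans (ENNReal.ofReal_le_ofReal (not_le.1 ht).le)

end mdist

/-- Strongly measurable functions on the line are approximated in measure by continuous functions
with compact support. -/
lemma exists_hasCompactSupport_mdist_lt {X : Type*} [NormedAddCommGroup X] [NormedSpace ℝ X]
    {f : ℝ → X} (hf : StronglyMeasurable f) (μ : Measure ℝ) [IsFiniteMeasure μ] {r : ℝ}
    (hr : 0 < r) :
    ∃ φ : ℝ → X, Continuous φ ∧ HasCompactSupport φ ∧ mdist μ f φ < ENNReal.ofReal r := by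
  have hlim : Tendsto (fun n => mdist μ f (hf.approx n)) atTop (𝓝 0) := by
    have := tendsto_lintegral_of_dominated_convergence (μ := μ)
      (F := fun n t => min 1 (edist (f t) (hf.approx n t))) (f := fun _ => 0) (fun _ => 1)
      (fun n => measurable_min_one_edist hf (hf.approx n).stronglyMeasurable)
      (fun n => Eventually.of_forall fun t => min_le_left _ _) (by simp)
      (Eventually.of_forall fun t => by
        have h1 : Tendsto (fun n => edist (f t) (hf.approx n t)) atTop (𝓝 0) := by
          simpa using (tendsto_const_nhds (x := f t)).edist (hf.tendsto_approx t)
        simpa using tendsto_const_nhds.min h1)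
    simpa [mdist] using this
  have hr2 : 0 < ENNReal.ofReal (r / 2) := ENNReal.ofReal_pos.2 (by positivity)
  obtain ⟨n, hn⟩ := (hlim.eventually (gt_mem_nhds hr2)).exists
  have hint : Integrable (hf.approx n) μ := SimpleFunc.integrable_of_isFiniteMeasure _
  obtain ⟨φ, hφs, hφ, hφc, hφi⟩ :=
    hint.exists_hasCompactSupport_integral_sub_le (ε := r / 2) (by positivity)
  refine ⟨φ, hφc, hφs, ?_⟩
  have h2 : mdist μ (hf.approx n) φ ≤ ENNReal.ofReal (r / 2) := by
    refine le_trans ?_ (ENNReal.ofReal_le_ofReal hφ)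
    have h3 := ofReal_integral_norm_eq_lintegral_enorm (hint.sub hφi)
    simp only [Pi.sub_apply] at h3
    rw [h3]
    refine lintegral_mono fun t => (min_le_right _ _).trans_eq ?_
    rw [edist_eq_enorm_sub]
  calc mdist μ f φ ≤ mdist μ f (hf.approx n) + mdist μ (hf.approx n) φ :=
        mdist_triangle hf (hf.approx n).stronglyMeasurable
    _ < ENNReal.ofReal (r / 2) + ENNReal.ofReal (r / 2) :=
        ENNReal.add_lt_add_of_lt_of_le (ne_top_of_le_ne_top ENNReal.ofReal_ne_top h2) hn h2
    _ = ENNReal.ofReal r := by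
        rw [← ENNReal.ofReal_add (by positivity) (by positivity), add_halves]

/-- Lebesgue measure on the unit interval `[0, 1)`. -/
noncomputable abbrev unitMeasure : Measure ℝ := volume.restrict (Set.Ico 0 1)

instance : IsProbabilityMeasure unitMeasure := ⟨by simp [unitMeasure]⟩

/-- For `t` in the unit interval, the integer part and the fractional part of `M * t` are
independent. -/
lemma lintegral_floor_fract {M : ℕ} (hM : 0 < M) {Φ : ℕ → ℝ → ENNReal}
    (hΦ : ∀ q, Measurable (Φ q)) :
    ∫⁻ t, Φ ⌊M * t⌋₊ (Int.fract (M * t)) ∂unitMeasure =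
      ∫⁻ w, ∫⁻ t, Φ ⌊M * t⌋₊ w ∂unitMeasure ∂unitMeasure := by
  have hMR : (0 : ℝ) < M := by exact_mod_cast hM
  have hscale : ∀ Ψ : ℝ → ENNReal, ∫⁻ t, Ψ (M * t) ∂unitMeasure =
      ENNReal.ofReal (M : ℝ)⁻¹ * ∫⁻ s in Set.Ico (0 : ℝ) M, Ψ s := by
    intro Ψ
    rw [← lintegral_indicator measurableSet_Ico, ← lintegral_indicator measurableSet_Ico]
    have h1 : (Set.Ico (0 : ℝ) 1).indicator (fun t => Ψ (M * t)) =
        fun t => (Set.Ico (0 : ℝ) M).indicator Ψ (M * t) := by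
      ext t
      have : t ∈ Set.Ico (0 : ℝ) 1 ↔ (M : ℝ) * t ∈ Set.Ico (0 : ℝ) M := by
        simp only [Set.mem_Ico]
        constructor
        · rintro ⟨h1, h2⟩
          exact ⟨by positivity, by nlinarith⟩
        · rintro ⟨h1, h2⟩
          exact ⟨by by_contra! h; nlinarith, by by_contra! h; nlinarith⟩
      by_cases h : t ∈ Set.Ico (0 : ℝ) 1
      · rw [Set.indicator_of_mem h, Set.indicator_of_mem (this.1 h)]
      · rw [Set.indicator_of_notMem h, Set.indicator_of_notMem (fun h' => h (this.2 h'))]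
    have h2 := lintegral_map_equiv (μ := volume) ((Set.Ico (0 : ℝ) M).indicator Ψ)
      (MeasurableEquiv.mulLeft₀ (M : ℝ) hMR.ne')
    rw [MeasurableEquiv.coe_mulLeft₀, Real.map_volume_mul_left hMR.ne', lintegral_smul_measure,
      abs_of_pos (inv_pos.2 hMR)] at h2
    rw [h1, ← h2, smul_eq_mul]
  have hsum : ∀ (N : ℕ) (Ψ : ℝ → ENNReal), ∫⁻ s in Set.Ico (0 : ℝ) N, Ψ s =
      ∑ q ∈ Finset.range N, ∫⁻ w, Ψ (q + w) ∂unitMeasure := by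
    intro N Ψ
    induction N with
    | zero => simp
    | succ N ih =>
      have h1 : Set.Ico (0 : ℝ) ((N + 1 : ℕ) : ℝ) = Set.Ico 0 (N : ℝ) ∪ Set.Ico (N : ℝ) (N + 1) := by
        push_cast
        rw [Set.Ico_union_Ico_eq_Ico (by positivity) (by linarith)]
      rw [Finset.sum_range_succ, ← ih, h1, lintegral_union measurableSet_Ico
        (Set.Ico_disjoint_Ico_same)]
      congr 1
      rw [← lintegral_indicator measurableSet_Ico, ← lintegral_indicator measurableSet_Ico,
        ← lintegral_add_left_eq_self _ (N : ℝ)]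
      congr 1
      ext w
      simp [Set.indicator]
  have hcell : ∀ Ψ : ℕ → ℝ → ENNReal, ∫⁻ t, Ψ ⌊M * t⌋₊ (Int.fract (M * t)) ∂unitMeasure =
      ENNReal.ofReal (M : ℝ)⁻¹ * ∑ q ∈ Finset.range M, ∫⁻ w, Ψ q w ∂unitMeasure := by
    intro Ψ
    rw [hscale fun s => Ψ ⌊s⌋₊ (Int.fract s), hsum]
    congr 1
    refine Finset.sum_congr rfl fun q _ => setLIntegral_congr_fun measurableSet_Ico fun w hw => ?_
    have h1 : ⌊(q : ℝ) + w⌋₊ = q := by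
      rw [Nat.floor_eq_iff (by have := hw.1; positivity)]
      exact ⟨by linarith [hw.1], by linarith [hw.2]⟩
    have h2 : Int.fract ((q : ℝ) + w) = w := by
      rw [Int.fract_natCast_add]
      exact Int.fract_eq_self.2 hw
    simp only [h1, h2]
  rw [hcell Φ]
  have hinner : ∀ w, ∫⁻ t, Φ ⌊M * t⌋₊ w ∂unitMeasure =
      ENNReal.ofReal (M : ℝ)⁻¹ * ∑ q ∈ Finset.range M, Φ q w := by
    intro w
    rw [hcell fun q _ => Φ q w]
    simp
  simp only [hinner]
  rw [lintegral_const_mul _ (Finset.measurable_sum _ fun q _ => hΦ q),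
    lintegral_finsetSum _ fun q _ => hΦ q]

/-- Strongly measurable functions on the unit interval are approximated in measure by functions
constant on the cells of all sufficiently fine subdivisions. -/
lemma eventually_exists_step_mdist_lt {X : Type*} [NormedAddCommGroup X] [NormedSpace ℝ X]
    {f : ℝ → X} (hf : StronglyMeasurable f) {r : ℝ} (hr : 0 < r) :
    ∀ᶠ M : ℕ in atTop, ∃ σ : ℕ → X,
      mdist unitMeasure f (fun t => σ ⌊M * t⌋₊) < ENNReal.ofReal r := by
  obtain ⟨φ, hφc, hφs, hφ⟩ := exists_hasCompactSupport_mdist_lt hf unitMeasure (half_pos hr)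
  obtain ⟨δ, hδ, hφδ⟩ := Metric.uniformContinuous_iff.1
    (hφs.uniformContinuous_of_continuous hφc) (r / 2) (half_pos hr)
  filter_upwards [eventually_gt_atTop ⌈δ⁻¹⌉₊] with M hM
  have hM' : δ⁻¹ < M := (Nat.le_ceil _).trans_lt (by exact_mod_cast hM)
  have hM0 : (0 : ℝ) < M := (inv_pos.2 hδ).trans hM'
  refine ⟨fun q => φ (q / M), ?_⟩
  have h2 : mdist unitMeasure φ (fun t => φ (⌊M * t⌋₊ / M)) ≤ ENNReal.ofReal (r / 2) := by
    calc mdist unitMeasure φ (fun t => φ (⌊M * t⌋₊ / M))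
        ≤ ∫⁻ _, ENNReal.ofReal (r / 2) ∂unitMeasure := by
          refine setLIntegral_mono' measurableSet_Ico fun t ht => (min_le_right _ _).trans ?_
          rw [edist_dist]
          refine ENNReal.ofReal_le_ofReal (hφδ ?_).le
          have hpos : 0 ≤ (M : ℝ) * t := mul_nonneg hM0.le ht.1
          have h3 := Nat.floor_le hpos
          have h4 := Nat.lt_floor_add_one ((M : ℝ) * t)
          have h5 : t - ⌊(M : ℝ) * t⌋₊ / M = (M * t - ⌊(M : ℝ) * t⌋₊) / M := by
            field_simp
          rw [Real.dist_eq, h5, abs_of_nonneg (div_nonneg (by linarith) hM0.le),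
            div_lt_iff₀ hM0]
          have : 1 < δ * M := by
            rw [inv_lt_iff_one_lt_mul₀' hδ] at hM'
            exact hM'
          linarith
      _ = ENNReal.ofReal (r / 2) := by simp
  calc mdist unitMeasure f (fun t => φ (⌊M * t⌋₊ / M))
      ≤ mdist unitMeasure f φ + mdist unitMeasure φ (fun t => φ (⌊M * t⌋₊ / M)) :=
        mdist_triangle hf hφc.stronglyMeasurable
    _ < ENNReal.ofReal (r / 2) + ENNReal.ofReal (r / 2) :=
        ENNReal.add_lt_add_of_lt_of_le (ne_top_of_le_ne_top ENNReal.ofReal_ne_top h2) hφ h2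
    _ = ENNReal.ofReal r := by
        rw [← ENNReal.ofReal_add (by positivity) (by positivity), add_halves]

lemma unitMeasure_fract_preimage_le {M : ℕ} (hM : 0 < M) {K : Set ℝ} (hK : MeasurableSet K) :
    unitMeasure {t | Int.fract (M * t) ∈ K} ≤ volume K := by
  have h1 : MeasurableSet {t : ℝ | Int.fract (M * t) ∈ K} :=
    (measurable_fract.comp (measurable_const_mul (M : ℝ))) hK
  have h2 := lintegral_floor_fract hM (Φ := fun _ => K.indicator 1)
    fun _ => measurable_one.indicator hK
  rw [← lintegral_indicator_one h1]
  refine h2.trans_le ?_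
  simp only [lintegral_const, measure_univ, mul_one]
  rw [lintegral_indicator_one hK]
  exact Measure.restrict_apply_le _ _

/-- A totally bounded family in the topology of convergence in measure on the unit interval admits
uniformly continuous approximations taking finitely many values. -/
lemma exists_finite_valued_approx {ι X : Type*} [NormedAddCommGroup X] [NormedSpace ℝ X]
    {F : ι → ℝ → X} (hF : ∀ n, StronglyMeasurable (F n))
    (htb : ∀ r > 0, ∃ (N : ℕ) (m : ℕ → ι), ∀ n, ∃ i < N,
      mdist unitMeasure (F n) (F (m i)) < ENNReal.ofReal r) {r : ℝ} (hr : 0 < r) :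
    ∃ G : ι → ℝ → X, (∀ n, StronglyMeasurable (G n)) ∧
      (∃ V : Set X, V.Finite ∧ ∀ n, ∀ t ∈ Set.Ico (0 : ℝ) 1, G n t ∈ V) ∧
      (∀ n, mdist unitMeasure (F n) (G n) ≤ ENNReal.ofReal (4 * r)) ∧
      ∀ δ > 0, ∃ η > 0, ∀ n m, mdist unitMeasure (F n) (F m) ≤ ENNReal.ofReal η →
        unitMeasure {t | G n t ≠ G m t} ≤ ENNReal.ofReal δ := by
  obtain ⟨N, p, hp⟩ := htb (r / 2) (half_pos hr)
  have hev : ∀ᶠ M : ℕ in atTop, ∀ i ∈ Finset.range N, ∃ σ : ℕ → X,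
      mdist unitMeasure (F (p i)) (fun t => σ ⌊M * t⌋₊) < ENNReal.ofReal (r / 2) :=
    (Filter.eventually_all_finset _).2 fun i _ =>
      eventually_exists_step_mdist_lt (hF (p i)) (half_pos hr)
  obtain ⟨M, hMσ, hM⟩ := (hev.and (eventually_gt_atTop 0)).exists
  choose! σ hσ using hMσ
  have hMR : (0 : ℝ) < M := by exact_mod_cast hM
  have hq : Measurable fun t : ℝ => ⌊M * t⌋₊ :=
    Nat.measurable_floor.comp (measurable_const_mul (M : ℝ))
  have hu : Measurable fun t : ℝ => Int.fract (M * t) :=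
    measurable_fract.comp (measurable_const_mul (M : ℝ))
  let S : ℕ → ℝ → X := fun i t => σ i ⌊M * t⌋₊
  have hS : ∀ i, StronglyMeasurable (S i) := fun i =>
    (StronglyMeasurable.of_discrete (f := σ i)).comp_measurable hq
  let a : ℕ → ι → ℝ := fun i n => (mdist unitMeasure (F n) (S i)).toReal
  have hfin : ∀ i n, mdist unitMeasure (F n) (S i) ≠ ⊤ := fun i n =>
    ne_top_of_le_ne_top (measure_ne_top unitMeasure Set.univ) mdist_le_measure_univ
  have ha_eq : ∀ i n, mdist unitMeasure (F n) (S i) = ENNReal.ofReal (a i n) := fun i n =>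
    (ENNReal.ofReal_toReal (hfin i n)).symm
  have hnear : ∀ n, ∃ i < N, a i n < r := by
    intro n
    obtain ⟨i, hi, hni⟩ := hp n
    refine ⟨i, hi, ?_⟩
    rw [← ENNReal.ofReal_lt_ofReal_iff hr, ← ha_eq]
    calc mdist unitMeasure (F n) (S i)
        ≤ mdist unitMeasure (F n) (F (p i)) + mdist unitMeasure (F (p i)) (S i) :=
          mdist_triangle (hF _) (hF _)
      _ < ENNReal.ofReal (r / 2) + ENNReal.ofReal (r / 2) :=
          ENNReal.add_lt_add hni (hσ i (Finset.mem_range.2 hi))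
      _ = ENNReal.ofReal r := by
          rw [← ENNReal.ofReal_add (by positivity) (by positivity), add_halves]
  let I : ι → ℝ → ℕ := fun n w => sInf {i | a i n < r * (1 + w) ∨ N ≤ i}
  have hI : ∀ n w, 0 ≤ w → I n w < N ∧ a (I n w) n < r * (1 + w) := by
    intro n w hw
    obtain ⟨i, hi, hni⟩ := hnear n
    have hmem : i ∈ {i | a i n < r * (1 + w) ∨ N ≤ i} := Or.inl (by nlinarith)
    have h1 : I n w < N := (Nat.sInf_le hmem).trans_lt hi
    refine ⟨h1, ?_⟩
    rcases Nat.sInf_mem ⟨i, hmem⟩ with h | h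
    · exact h
    · exact absurd h (not_le.2 h1)
  have hIm : ∀ n, Measurable (I n) := by
    intro n
    refine Antitone.measurable fun w w' hww' => ?_
    have hmem : I n w ∈ {i | a i n < r * (1 + w) ∨ N ≤ i} := Nat.sInf_mem ⟨N, Or.inr le_rfl⟩
    refine Nat.sInf_le (hmem.imp (fun h => h.trans_le ?_) id)
    nlinarith
  have hu0 : ∀ t : ℝ, 0 ≤ Int.fract (M * t) := fun t => Int.fract_nonneg _
  let G : ι → ℝ → X := fun n t => S (I n (Int.fract (M * t))) t
  have hG : ∀ n, StronglyMeasurable (G n) := fun n =>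
    (StronglyMeasurable.of_discrete (f := fun z : ℕ × ℕ => σ z.1 z.2)).comp_measurable
      (((hIm n).comp hu).prodMk hq)
  refine ⟨G, hG, ⟨(fun z : ℕ × ℕ => σ z.1 z.2) '' (Set.Iio N ×ˢ Set.Iio M),
    ((Set.finite_Iio N).prod (Set.finite_Iio M)).image _, ?_⟩, ?_, ?_⟩
  · intro n t ht
    refine ⟨(I n (Int.fract (M * t)), ⌊M * t⌋₊), ⟨(hI n _ (hu0 t)).1, ?_⟩, rfl⟩
    rw [Set.mem_Iio, Nat.floor_lt (mul_nonneg hMR.le ht.1)]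
    nlinarith [ht.2]
  · intro n
    obtain ⟨j, hj, hnj⟩ := hnear n
    have h1 : mdist unitMeasure (S j) (G n) ≤ ENNReal.ofReal (3 * r) := by
      have h2 := lintegral_floor_fract hM
        (Φ := fun q w => min 1 (edist (σ j q) (σ (I n w) q))) fun q =>
          ((Measurable.of_discrete (f := fun i : ℕ => min 1 (edist (σ j q) (σ i q))))).comp
            (hIm n)
      refine h2.trans_le ?_
      calc ∫⁻ w, ∫⁻ t, min 1 (edist (σ j ⌊M * t⌋₊) (σ (I n w) ⌊M * t⌋₊)) ∂unitMeasure ∂unitMeasure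
          ≤ ∫⁻ _, ENNReal.ofReal (3 * r) ∂unitMeasure := by
            refine setLIntegral_mono' measurableSet_Ico fun w hw => ?_
            have h3 := (hI n w hw.1).2
            calc mdist unitMeasure (S j) (S (I n w))
                ≤ mdist unitMeasure (S j) (F n) + mdist unitMeasure (F n) (S (I n w)) :=
                  mdist_triangle (hS _) (hF _)
              _ = ENNReal.ofReal (a j n + a (I n w) n) := by
                  rw [mdist_comm, ha_eq, ha_eq,
                    ENNReal.ofReal_add ENNReal.toReal_nonneg ENNReal.toReal_nonneg]
              _ ≤ ENNReal.ofReal (3 * r) := by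
                  refine ENNReal.ofReal_le_ofReal ?_
                  nlinarith [hw.2]
        _ = ENNReal.ofReal (3 * r) := by simp
    calc mdist unitMeasure (F n) (G n)
        ≤ mdist unitMeasure (F n) (S j) + mdist unitMeasure (S j) (G n) :=
          mdist_triangle (hF _) (hS _)
      _ ≤ ENNReal.ofReal r + ENNReal.ofReal (3 * r) := by
          refine add_le_add ?_ h1
          rw [ha_eq]
          exact ENNReal.ofReal_le_ofReal hnj.le
      _ = ENNReal.ofReal (4 * r) := by
          rw [← ENNReal.ofReal_add (by positivity) (by positivity)]
          ring_nf
  · intro δ hδ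
    refine ⟨r * δ / (N + 1), by positivity, fun n m hnm => ?_⟩
    set η := r * δ / (N + 1) with hη
    have hη0 : 0 < η := by positivity
    have hlip : ∀ n m, mdist unitMeasure (F n) (F m) ≤ ENNReal.ofReal η →
        ∀ i, a i n ≤ a i m + η := by
      intro n m hnm i
      rw [← ENNReal.ofReal_le_ofReal_iff (add_nonneg ENNReal.toReal_nonneg hη0.le), ← ha_eq,
        ENNReal.ofReal_add ENNReal.toReal_nonneg hη0.le, ← ha_eq, add_comm]
      exact (mdist_triangle (hF _) (hF _)).trans (add_le_add_left hnm _)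
    let K : ℕ → Set ℝ := fun i => Set.Icc (min (a i n) (a i m) / r - 1) (max (a i n) (a i m) / r - 1)
    have hsub : {t | G n t ≠ G m t} ⊆ ⋃ i ∈ Finset.range N, {t | Int.fract (M * t) ∈ K i} := by
      intro t ht
      by_contra hcon
      simp only [Set.mem_iUnion, not_exists, Finset.mem_range] at hcon
      refine ht ?_
      have hII : I n (Int.fract (M * t)) = I m (Int.fract (M * t)) := by
        refine congrArg sInf (Set.ext fun i => ?_)
        by_cases hi : N ≤ i
        · simp [hi]
        · have hK := hcon i (not_le.1 hi)
          simp only [Set.mem_ofPred_eq, K, Set.mem_Icc, not_and_or, not_le, lt_sub_iff_add_lt,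
            sub_lt_iff_lt_add, lt_div_iff₀ hr, div_lt_iff₀ hr, lt_min_iff, max_lt_iff] at hK
          simp only [Set.mem_ofPred_eq, hi, or_false]
          rcases hK with ⟨h1, h2⟩ | ⟨h1, h2⟩
          · constructor <;> intro h <;> nlinarith
          · constructor <;> intro h <;> nlinarith
      simp only [G, hII]
    have hKvol : ∀ i, volume (K i) ≤ ENNReal.ofReal (η / r) := by
      intro i
      rw [Real.volume_Icc]
      refine ENNReal.ofReal_le_ofReal ?_
      have h1 := hlip n m hnm i
      have h2 := hlip m n (by rwa [mdist_comm]) i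
      have h3 : max (a i n) (a i m) - min (a i n) (a i m) ≤ η := by
        rcases le_total (a i n) (a i m) with h | h
        · rw [max_eq_right h, min_eq_left h]; linarith
        · rw [max_eq_left h, min_eq_right h]; linarith
      calc _ = (max (a i n) (a i m) - min (a i n) (a i m)) / r := by ring
        _ ≤ η / r := by gcongr
    calc unitMeasure {t | G n t ≠ G m t}
        ≤ ∑ i ∈ Finset.range N, unitMeasure {t | Int.fract (M * t) ∈ K i} :=
          (measure_mono hsub).trans (measure_biUnion_finset_le _ _)
      _ ≤ ∑ i ∈ Finset.range N, ENNReal.ofReal (η / r) :=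
          Finset.sum_le_sum fun i _ =>
            (unitMeasure_fract_preimage_le hM measurableSet_Icc).trans (hKvol i)
      _ = ENNReal.ofReal (N * (η / r)) := by
          rw [Finset.sum_const, Finset.card_range, nsmul_eq_mul, ENNReal.ofReal_mul (by positivity),
            ENNReal.ofReal_natCast]
      _ ≤ ENNReal.ofReal δ := by
          refine ENNReal.ofReal_le_ofReal ?_
          have : N * (η / r) = N / (N + 1) * δ := by
            rw [hη]; field_simp
          rw [this]
          have h1 : (N : ℝ) / (N + 1) ≤ 1 := by
            rw [div_le_one (by positivity)]; linarith
          nlinarith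

open scoped symmDiff in
/-- The union of a sequence of uniformly continuous families of sets with uniformly summable
measures is uniformly continuous. -/
lemma iUnion_symmDiff_uniform {ι α : Type*} [MeasurableSpace α] {μ : Measure α}
    {d : ι → ι → ENNReal} {B : ℕ → ι → Set α} {b : ℕ → ENNReal} (hb : ∑' k, b k ≠ ⊤)
    (hB : ∀ k n, μ (B k n) ≤ b k)
    (hBd : ∀ k, ∀ δ > 0, ∃ η > 0, ∀ n m, d n m ≤ ENNReal.ofReal η →
      μ (B k n ∆ B k m) ≤ ENNReal.ofReal δ) :
    ∀ δ > 0, ∃ η > 0, ∀ n m, d n m ≤ ENNReal.ofReal η →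
      μ ((⋃ k, B k n) ∆ (⋃ k, B k m)) ≤ ENNReal.ofReal δ := by
  intro δ hδ
  have h2 : Tendsto (fun K => 2 * ∑' k, b (k + K)) atTop (𝓝 0) := by
    simpa using ENNReal.Tendsto.const_mul (ENNReal.tendsto_sum_nat_add b hb)
      (Or.inr ENNReal.ofNat_ne_top)
  obtain ⟨K, hK⟩ := (h2.eventually (ge_mem_nhds
    (ENNReal.ofReal_pos.2 (half_pos hδ)))).exists
  choose η hη hηB using fun k => hBd k (δ / 2 / (K + 1)) (by positivity)
  obtain ⟨η₀, hη₀, hη₀'⟩ : ∃ η₀ > 0, ∀ k ∈ Finset.range K, η₀ ≤ η k := by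
    have : ∀ᶠ e in 𝓝[>] (0 : ℝ), ∀ k ∈ Finset.range K, e ≤ η k :=
      (Filter.eventually_all_finset _).2 fun k _ =>
        eventually_nhdsWithin_of_eventually_nhds (ge_mem_nhds (hη k))
    obtain ⟨e, he, he0⟩ := (this.and self_mem_nhdsWithin).exists
    exact ⟨e, he0, he⟩
  refine ⟨η₀, hη₀, fun n m hnm => ?_⟩
  have hsub : (⋃ k, B k n) ∆ (⋃ k, B k m) ⊆
      (⋃ k ∈ Finset.range K, B k n ∆ B k m) ∪ ⋃ k, (B (k + K) n ∪ B (k + K) m) := by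
    have key : ∀ n m x, x ∈ (⋃ k, B k n) \ (⋃ k, B k m) →
        (∃ k < K, x ∈ B k n \ B k m) ∨ ∃ k, x ∈ B (k + K) n := by
      rintro n m x ⟨hx1, hx2⟩
      obtain ⟨k, hk⟩ := Set.mem_iUnion.1 hx1
      rcases lt_or_ge k K with h | h
      · exact Or.inl ⟨k, h, hk, fun h' => hx2 (Set.mem_iUnion.2 ⟨k, h'⟩)⟩
      · exact Or.inr ⟨k - K, by rwa [Nat.sub_add_cancel h]⟩
    simp only [Set.symmDiff_def]
    rintro x (hx | hx)
    · rcases key n m x hx with ⟨k, hk, h⟩ | ⟨k, h⟩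
      · exact Or.inl (Set.mem_biUnion (Finset.mem_range.2 hk) (Or.inl h))
      · exact Or.inr (Set.mem_iUnion.2 ⟨k, Or.inl h⟩)
    · rcases key m n x hx with ⟨k, hk, h⟩ | ⟨k, h⟩
      · exact Or.inl (Set.mem_biUnion (Finset.mem_range.2 hk) (Or.inr h))
      · exact Or.inr (Set.mem_iUnion.2 ⟨k, Or.inr h⟩)
  have hhead : μ (⋃ k ∈ Finset.range K, B k n ∆ B k m) ≤ ENNReal.ofReal (δ / 2) := by
    calc μ (⋃ k ∈ Finset.range K, B k n ∆ B k m)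
        ≤ ∑ k ∈ Finset.range K, μ (B k n ∆ B k m) := measure_biUnion_finset_le _ _
      _ ≤ ∑ k ∈ Finset.range K, ENNReal.ofReal (δ / 2 / (K + 1)) :=
          Finset.sum_le_sum fun k hk => hηB k n m
            (hnm.trans (ENNReal.ofReal_le_ofReal (hη₀' k hk)))
      _ = ENNReal.ofReal (K * (δ / 2 / (K + 1))) := by
          rw [Finset.sum_const, Finset.card_range, nsmul_eq_mul, ENNReal.ofReal_mul (by positivity),
            ENNReal.ofReal_natCast]
      _ ≤ ENNReal.ofReal (δ / 2) := by
          refine ENNReal.ofReal_le_ofReal ?_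
          have : K * (δ / 2 / (K + 1)) = K / (K + 1) * (δ / 2) := by field_simp
          rw [this]
          have h1 : (K : ℝ) / (K + 1) ≤ 1 := by
            rw [div_le_one (by positivity)]; linarith
          nlinarith
  have htail : μ (⋃ k, (B (k + K) n ∪ B (k + K) m)) ≤ ENNReal.ofReal (δ / 2) := by
    calc μ (⋃ k, (B (k + K) n ∪ B (k + K) m))
        ≤ ∑' k, μ (B (k + K) n ∪ B (k + K) m) := measure_iUnion_le _
      _ ≤ ∑' k, 2 * b (k + K) := ENNReal.tsum_le_tsum fun k =>
          (measure_union_le _ _).trans (by rw [two_mul]; exact add_le_add (hB _ _) (hB _ _))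
      _ = 2 * ∑' k, b (k + K) := ENNReal.tsum_mul_left
      _ ≤ _ := hK
  calc μ ((⋃ k, B k n) ∆ (⋃ k, B k m))
      ≤ ENNReal.ofReal (δ / 2) + ENNReal.ofReal (δ / 2) :=
        (measure_mono hsub).trans ((measure_union_le _ _).trans (add_le_add hhead htail))
    _ = ENNReal.ofReal δ := by
        rw [← ENNReal.ofReal_add (by positivity) (by positivity), add_halves]

open scoped symmDiff in
/-- A totally bounded family in the topology of convergence in measure on the unit interval takes
values in a common compact set, off exceptional sets which are small and depend uniformly
continuously on the member of the family. -/
lemma exists_compact_uniform_sets {ι X : Type*} [NormedAddCommGroup X] [NormedSpace ℝ X]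
    [CompleteSpace X] {F : ι → ℝ → X} (hF : ∀ n, StronglyMeasurable (F n))
    (htb : ∀ r > 0, ∃ (N : ℕ) (m : ℕ → ι), ∀ n, ∃ i < N,
      mdist unitMeasure (F n) (F (m i)) < ENNReal.ofReal r) {ε : ℝ} (hε : 0 < ε) :
    ∃ (T : ι → Set ℝ) (K : Set X), IsCompact K ∧ (∀ n, MeasurableSet (T n)) ∧
      (∀ n, unitMeasure (T n)ᶜ ≤ ENNReal.ofReal ε) ∧
      (∀ n, ∀ t ∈ Set.Ico (0 : ℝ) 1, t ∈ T n → F n t ∈ K) ∧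
      ∀ δ > 0, ∃ η > 0, ∀ n m, mdist unitMeasure (F n) (F m) ≤ ENNReal.ofReal η →
        unitMeasure (T n ∆ T m) ≤ ENNReal.ofReal δ := by
  let e : ℕ → ℝ := fun k => (1 / 2) ^ k
  have he : ∀ k, 0 < e k := fun k => by positivity
  have he1 : ∀ k, e k ≤ 1 := fun k => pow_le_one₀ (by norm_num) (by norm_num)
  have hes : ∀ k, e (k + 1) = e k / 2 := fun k => by simp only [e, pow_succ]; ring
  choose G hG hV hFG hGd using fun k =>
    exists_finite_valued_approx hF htb (r := e k * (ε / 4 * e k) / 4)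
      (by have := he k; positivity)
  choose V hGV using hV
  have hFGm : ∀ k n, unitMeasure {t | e k ≤ dist (F n t) (G k n t)} ≤
      ENNReal.ofReal (ε / 4 * e k) := by
    intro k n
    have h1 := (ofReal_mul_measure_le_mdist (μ := unitMeasure) (hF n) (hG k n) (he1 k)).trans
      (hFG k n)
    rw [mul_div_cancel₀ _ (by norm_num : (4 : ℝ) ≠ 0), ENNReal.ofReal_mul (he k).le] at h1
    exact (ENNReal.mul_le_mul_iff_right (ENNReal.ofReal_pos.2 (he k)).ne'
      ENNReal.ofReal_ne_top).1 h1
  let B : ℕ → ι → Set ℝ := fun k n => {t | 2 * e k < dist (G k n t) (G (k + 1) n t)}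
  let b : ℕ → ENNReal := fun k => ENNReal.ofReal (ε / 2 * e k)
  have hB : ∀ k n, unitMeasure (B k n) ≤ b k := by
    intro k n
    have hsub : B k n ⊆ {t | e k ≤ dist (F n t) (G k n t)} ∪
        {t | e (k + 1) ≤ dist (F n t) (G (k + 1) n t)} := by
      intro t ht
      by_contra hcon
      simp only [Set.mem_union, Set.mem_ofPred_eq, not_or, not_le] at hcon
      have h1 : 2 * e k < dist (G k n t) (G (k + 1) n t) := ht
      have h2 := dist_triangle_left (G k n t) (G (k + 1) n t) (F n t)
      linarith [hcon.1, hcon.2, hes k, he k]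
    calc unitMeasure (B k n)
        ≤ ENNReal.ofReal (ε / 4 * e k) + ENNReal.ofReal (ε / 4 * e (k + 1)) :=
          (measure_mono hsub).trans
            ((measure_union_le _ _).trans (add_le_add (hFGm k n) (hFGm (k + 1) n)))
      _ = ENNReal.ofReal (ε / 4 * e k + ε / 4 * e (k + 1)) := by
          have h1 := he k
          have h2 := he (k + 1)
          rw [ENNReal.ofReal_add (by positivity) (by positivity)]
      _ ≤ b k := by
          refine ENNReal.ofReal_le_ofReal ?_
          rw [hes]
          nlinarith [he k]
  have hsum : ∀ c : ℝ, 0 < c → ∑' k, ENNReal.ofReal (c * e k) = ENNReal.ofReal (c * 2) := by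
    intro c hc
    rw [← ENNReal.ofReal_tsum_of_nonneg (fun k => (mul_pos hc (he k)).le)
      (summable_geometric_two.mul_left c), tsum_mul_left, tsum_geometric_two]
  have hbsum : ∑' k, b k = ENNReal.ofReal ε := by
    simp only [b]
    rw [hsum _ (half_pos hε), div_mul_cancel₀ _ (by norm_num : (2 : ℝ) ≠ 0)]
  have hBd : ∀ k, ∀ δ > 0, ∃ η > 0, ∀ n m, mdist unitMeasure (F n) (F m) ≤ ENNReal.ofReal η →
      unitMeasure (B k n ∆ B k m) ≤ ENNReal.ofReal δ := by
    intro k δ hδ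
    obtain ⟨η₁, hη₁, h1⟩ := hGd k (δ / 2) (half_pos hδ)
    obtain ⟨η₂, hη₂, h2⟩ := hGd (k + 1) (δ / 2) (half_pos hδ)
    refine ⟨min η₁ η₂, lt_min hη₁ hη₂, fun n m hnm => ?_⟩
    have hsub : B k n ∆ B k m ⊆ {t | G k n t ≠ G k m t} ∪
        {t | G (k + 1) n t ≠ G (k + 1) m t} := by
      intro t ht
      by_contra hcon
      simp only [Set.mem_union, Set.mem_ofPred_eq, not_or, not_not] at hcon
      simp only [B, Set.mem_symmDiff, Set.mem_ofPred_eq, hcon.1, hcon.2] at ht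
      tauto
    calc unitMeasure (B k n ∆ B k m)
        ≤ ENNReal.ofReal (δ / 2) + ENNReal.ofReal (δ / 2) :=
          (measure_mono hsub).trans ((measure_union_le _ _).trans (add_le_add
            (h1 n m (hnm.trans (ENNReal.ofReal_le_ofReal (min_le_left _ _))))
            (h2 n m (hnm.trans (ENNReal.ofReal_le_ofReal (min_le_right _ _))))))
      _ = ENNReal.ofReal δ := by
          rw [← ENNReal.ofReal_add (by positivity) (by positivity), add_halves]
  let T : ι → Set ℝ := fun n =>
    {t | ∀ k, dist (G k n t) (G (k + 1) n t) ≤ 2 * e k ∧ dist (F n t) (G k n t) ≤ 4 * e k}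
  have hTB : ∀ n, T n =ᵐ[unitMeasure] ((⋃ k, B k n)ᶜ : Set ℝ) := by
    intro n
    have hbc : ∀ᵐ t ∂unitMeasure, ∀ᶠ k in atTop, t ∉ {t | e k ≤ dist (F n t) (G k n t)} := by
      refine ae_eventually_notMem (ne_top_of_le_ne_top ?_
        (ENNReal.tsum_le_tsum fun k => hFGm k n))
      rw [hsum _ (by positivity)]
      exact ENNReal.ofReal_ne_top
    filter_upwards [hbc] with t ht
    refine propext ⟨fun h => ?_, fun h => ?_⟩
    · have h' : t ∈ T n := h
      change t ∈ (⋃ k, B k n)ᶜ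
      simp only [Set.mem_compl_iff, Set.mem_iUnion, not_exists]
      exact fun k => not_lt.2 (h' k).1
    · have h' : t ∈ (⋃ k, B k n)ᶜ := h
      simp only [Set.mem_compl_iff, Set.mem_iUnion, not_exists] at h'
      have h1 : ∀ k, dist (G k n t) (G (k + 1) n t) ≤ 2 * e k := fun k => not_lt.1 (h' k)
      obtain ⟨k₀, hk₀⟩ := eventually_atTop.1 ht
      have h2 : ∀ k, dist (F n t) (G k n t) ≤ 4 * e k := by
        intro k
        rcases le_total k₀ k with hk | hk
        · have h3 : dist (F n t) (G k n t) < e k := not_le.1 (hk₀ k hk)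
          linarith [he k]
        · refine Nat.decreasingInduction
            (motive := fun k _ => dist (F n t) (G k n t) ≤ 4 * e k) ?_ ?_ hk
          · intro j _ hj
            have h4 := dist_triangle_right (F n t) (G j n t) (G (j + 1) n t)
            linarith [h1 j, hes j]
          · have h3 : dist (F n t) (G k₀ n t) < e k₀ := not_le.1 (hk₀ k₀ le_rfl)
            linarith [he k₀]
      exact fun k => ⟨h1 k, h2 k⟩
  have hTm : ∀ n, MeasurableSet (T n) := by
    intro n
    refine MeasurableSet.congr (s := ⋂ k, {t | dist (G k n t) (G (k + 1) n t) ≤ 2 * e k} ∩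
      {t | dist (F n t) (G k n t) ≤ 4 * e k}) ?_ (by ext t; simp [T])
    exact MeasurableSet.iInter fun k =>
      (measurableSet_le ((hG k n).dist (hG (k + 1) n)).measurable measurable_const).inter
        (measurableSet_le ((hF n).dist (hG k n)).measurable measurable_const)
  let W : Set X := ⋃ n, F n '' (T n ∩ Set.Ico 0 1)
  have hW : TotallyBounded W := by
    rw [Metric.totallyBounded_iff]
    intro ρ hρ
    obtain ⟨k, hk⟩ := exists_pow_lt_of_lt_one (show 0 < ρ / 4 by positivity)
      (show (1 / 2 : ℝ) < 1 by norm_num)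
    refine ⟨V k, (hGV k).1, Set.iUnion_subset fun n => ?_⟩
    rintro _ ⟨t, ⟨htT, ht⟩, rfl⟩
    refine Set.mem_iUnion₂.2 ⟨G k n t, (hGV k).2 n t ht, ?_⟩
    rw [Metric.mem_ball]
    have h1 := (htT k).2
    have h2 : e k < ρ / 4 := hk
    linarith
  refine ⟨T, closure W, isCompact_iff_totallyBounded_isComplete.2
    ⟨hW.closure, isClosed_closure.isComplete⟩, hTm, fun n => ?_,
    fun n t ht htT => subset_closure (Set.mem_iUnion.2 ⟨n, t, ⟨htT, ht⟩, rfl⟩), ?_⟩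
  · rw [measure_congr (hTB n).compl, compl_compl, ← hbsum]
    exact (measure_iUnion_le _).trans (ENNReal.tsum_le_tsum fun k => hB k n)
  · intro δ hδ
    obtain ⟨η, hη, h1⟩ := iUnion_symmDiff_uniform (hbsum ▸ ENNReal.ofReal_ne_top) hB hBd δ hδ
    refine ⟨η, hη, fun n m hnm => ?_⟩
    rw [measure_congr ((hTB n).symmDiff (hTB m)), compl_symmDiff_compl]
    exact h1 n m hnm

lemma mdist_shift {X : Type*} [PseudoEMetricSpace X] (f g : ℝ → X) (x y c : ℝ) :
    mdist (volume.restrict (Set.Ico x y)) (fun t => f (t + c)) (fun t => g (t + c)) =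
      mdist (volume.restrict (Set.Ico (x + c) (y + c))) f g := by
  have h := (measurePreserving_add_right volume c).setLIntegral_comp_preimage_emb
    (measurableEmbedding_addRight c) (fun t => min 1 (edist (f t) (g t)))
    (Set.Ico (x + c) (y + c))
  rw [Set.preimage_add_const_Ico, add_sub_cancel_right, add_sub_cancel_right] at h
  exact h

lemma mdist_le_of_dist_le {α X : Type*} [MeasurableSpace α] [PseudoMetricSpace X]
    {μ : Measure α} {f g : α → X} {ε : ℝ} (h : ∀ t, dist (f t) (g t) ≤ ε) :
    mdist μ f g ≤ ENNReal.ofReal ε * μ Set.univ := by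
  rw [← lintegral_const]
  refine lintegral_mono fun t => (min_le_right _ _).trans ?_
  rw [edist_dist]
  exact ENNReal.ofReal_le_ofReal (h t)

/-- The Stepanov distance in measure between `f` and its translate by `τ`. -/
noncomputable def translateDist {X : Type*} [PseudoEMetricSpace X] (f : ℝ → X) (τ : ℝ) : ENNReal :=
  ⨆ x : ℝ, mdist (volume.restrict (Set.Ico x (x + 1))) (fun t => f (t + τ)) f

section translateDist

variable {X : Type*} [PseudoMetricSpace X] {f : ℝ → X}

lemma MeasureTheory.StronglyMeasurable.comp_add_right (hf : StronglyMeasurable f) (c : ℝ) :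
    StronglyMeasurable fun t => f (t + c) :=
  hf.comp_measurable (measurable_id.add_const c)

lemma mdist_shift_le_translateDist (f : ℝ → X) (x a τ : ℝ) :
    mdist (volume.restrict (Set.Ico x (x + 1))) (fun t => f (t + (τ + a))) (fun t => f (t + a)) ≤
      translateDist f τ := by
  have h := mdist_shift (fun t => f (t + τ)) f x (x + 1) a
  simp only [add_assoc, add_comm a τ] at h
  rw [h, add_comm 1 a, ← add_assoc]
  exact le_iSup (fun x => mdist (volume.restrict (Set.Ico x (x + 1))) (fun t => f (t + τ)) f)
    (x + a)

lemma translateDist_add_le (hf : StronglyMeasurable f) (a b : ℝ) :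
    translateDist f (a + b) ≤ translateDist f a + translateDist f b := by
  refine iSup_le fun x => ?_
  refine (mdist_triangle (hf.comp_add_right _) (hf.comp_add_right b)).trans (add_le_add ?_ ?_)
  · exact mdist_shift_le_translateDist f x b a
  · exact le_iSup (fun x => mdist (volume.restrict (Set.Ico x (x + 1))) (fun t => f (t + b)) f) x

lemma translateDist_neg_le (f : ℝ → X) (a : ℝ) : translateDist f (-a) ≤ translateDist f a := by
  refine iSup_le fun x => ?_
  rw [mdist_comm]
  have h := mdist_shift_le_translateDist f x (-a) a
  simpa only [add_neg_cancel, add_zero] using h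

lemma S0AP.relDense_translateDist (hf : StronglyMeasurable f) (h : S0AP f) {η : ℝ} (hη : 0 < η) :
    RelDense {τ | translateDist f τ ≤ ENNReal.ofReal η} := by
  obtain ⟨l, hl, h⟩ := h (η / 2) (half_pos hη) (η / 2) (half_pos hη)
  refine ⟨l, hl, fun a => ?_⟩
  obtain ⟨τ, hτ, hτa⟩ := h a
  refine ⟨τ, ?_, hτa⟩
  refine iSup_le (a := ENNReal.ofReal η) fun x => ?_
  refine (mdist_le_add (hf.comp_add_right τ) hf (η / 2)).trans ?_
  rw [← add_halves η, ENNReal.ofReal_add (half_pos hη).le (half_pos hη).le, add_halves]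
  refine add_le_add (by simp) ?_
  rw [Measure.restrict_apply' measurableSet_Ico]
  refine le_trans (measure_mono ?_) ((le_iSup (fun ξ : ℝ =>
    volume {t ∈ Set.Icc ξ (ξ + 1) | η / 2 ≤ dist (f (t + τ)) (f t)}) x).trans hτ.le)
  exact fun t ht => ⟨Set.Ico_subset_Icc_self ht.2, ht.1⟩

end translateDist

lemma ofReal_add_three {η : ℝ} (hη : 0 < η) :
    ENNReal.ofReal (η / 3) + ENNReal.ofReal (η / 3) + ENNReal.ofReal (η / 3) =
      ENNReal.ofReal η := by
  rw [← ENNReal.ofReal_add (by positivity) (by positivity),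
    ← ENNReal.ofReal_add (by positivity) (by positivity)]
  congr 1
  ring

/-- Translations act continuously on an `S⁰`-almost periodic function. -/
lemma S0AP.translateDist_small {X : Type*} [NormedAddCommGroup X] [NormedSpace ℝ X] {f : ℝ → X}
    (hf : StronglyMeasurable f) (h : S0AP f) {η : ℝ} (hη : 0 < η) :
    ∃ δ > 0, ∀ s, |s| < δ → translateDist f s ≤ ENNReal.ofReal η := by
  have hη3 : 0 < η / 3 := by positivity
  have hη9 : 0 < η / 3 / 3 := by positivity
  obtain ⟨l, hl, hτ⟩ := S0AP.relDense_translateDist hf h hη3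
  obtain ⟨φ, hφc, hφs, hφ⟩ := exists_hasCompactSupport_mdist_lt hf
    (volume.restrict (Set.Ico (-1) (l + 2))) hη9
  obtain ⟨δ, hδ, hφδ⟩ := Metric.uniformContinuous_iff.1
    (hφs.uniformContinuous_of_continuous hφc) (η / 3 / 3) hη9
  have hφm : StronglyMeasurable φ := hφc.stronglyMeasurable_of_hasCompactSupport hφs
  refine ⟨min 1 δ, lt_min one_pos hδ, fun s hs => iSup_le fun x => ?_⟩
  obtain ⟨hs1, hsδ⟩ := lt_min_iff.1 hs
  obtain ⟨τ, hτD, hτ1, hτ2⟩ := hτ (-x)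
  have hφle : ∀ y, -1 ≤ y → y ≤ l + 1 → mdist (volume.restrict (Set.Ico y (y + 1))) f φ ≤
      ENNReal.ofReal (η / 3 / 3) := fun y h1 h2 =>
    (mdist_mono_measure (Measure.restrict_mono
      (Set.Ico_subset_Ico h1 (by linarith)) le_rfl)).trans hφ.le
  have hmid : mdist (volume.restrict (Set.Ico (x + τ) (x + τ + 1))) (fun t => f (t + s)) f ≤
      ENNReal.ofReal (η / 3) := by
    refine (mdist_triangle (hf.comp_add_right s) hφm).trans ?_
    rw [← ofReal_add_three hη3]
    refine add_le_add ((mdist_triangle (hf.comp_add_right s) (hφm.comp_add_right s)).trans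
      (add_le_add ?_ ?_)) ?_
    · rw [mdist_shift, add_right_comm (x + τ) 1 s]
      exact hφle (x + τ + s) (by linarith [(abs_lt.1 hs1).1]) (by linarith [(abs_lt.1 hs1).2])
    · refine (mdist_le_of_dist_le (ε := η / 3 / 3) fun t => (hφδ ?_).le).trans (by simp)
      simpa [Real.dist_eq] using hsδ
    · rw [mdist_comm]
      exact hφle _ (by linarith) (by linarith)
  rw [← ofReal_add_three hη]
  refine (mdist_triangle (hf.comp_add_right s) (hf.comp_add_right τ)).trans (add_le_add
    ((mdist_triangle (hf.comp_add_right s) (hf.comp_add_right (τ + s))).trans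
    (add_le_add ?_ ?_)) ?_)
  · rw [mdist_comm]
    exact (mdist_shift_le_translateDist f x s τ).trans hτD
  · have h1 := mdist_shift (fun t => f (t + s)) f x (x + 1) τ
    simp only [add_assoc] at h1
    rw [h1]
    simpa only [add_comm τ 1, add_assoc] using hmid
  · exact (le_iSup (fun x =>
      mdist (volume.restrict (Set.Ico x (x + 1))) (fun t => f (t + τ)) f) x).trans hτD

/-- A function on the integers with finite range attains all its values on a bounded set. -/
lemma exists_natAbs_le_of_finite_range {α : Type*} {c : ℤ → α} (hc : (Set.range c).Finite) :
    ∃ R : ℕ, ∀ j, ∃ i : ℤ, i.natAbs ≤ R ∧ c i = c j := by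
  choose g hg using fun v : Set.range c => v.2
  have := hc.to_subtype
  obtain ⟨R, hR⟩ := (Set.finite_range fun v => (g v).natAbs).bddAbove
  exact ⟨R, fun j => ⟨g ⟨c j, j, rfl⟩, hR ⟨_, rfl⟩, hg ⟨c j, j, rfl⟩⟩⟩

/-- The integer almost periods of an `S⁰`-almost periodic function are relatively dense. -/
lemma S0AP.exists_int_translateDist_le {X : Type*} [NormedAddCommGroup X] [NormedSpace ℝ X]
    {f : ℝ → X} (hf : StronglyMeasurable f) (h : S0AP f) {η : ℝ} (hη : 0 < η) :
    ∃ L : ℕ, ∀ n : ℤ, ∃ k : ℤ, n ≤ k ∧ k ≤ n + L ∧ translateDist f k ≤ ENNReal.ofReal η := by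
  have hη3 : 0 < η / 3 := by positivity
  obtain ⟨δ, hδ, hD⟩ := S0AP.translateDist_small hf h hη3
  obtain ⟨l, hl, hτ⟩ := S0AP.relDense_translateDist hf h hη3
  obtain ⟨p, hp⟩ := exists_nat_ge l
  have hp0 : 0 < p := by
    have : (0 : ℝ) < p := hl.trans_le hp
    exact_mod_cast this
  choose τ hτD hτ using fun j : ℤ => hτ (j * p)
  let c : ℤ → ℕ := fun j => ⌊(τ j - j * p) / δ⌋₊
  have hc : (Set.range c).Finite := by
    refine (Set.finite_Iic ⌊l / δ⌋₊).subset ?_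
    rintro _ ⟨j, rfl⟩
    refine Nat.floor_le_floor (div_le_div_of_nonneg_right ?_ hδ.le)
    linarith [(hτ j).2]
  obtain ⟨R, hR⟩ := exists_natAbs_le_of_finite_range hc
  refine ⟨(1 + 2 * R) * p, fun n => ?_⟩
  obtain ⟨i, hiR, hi⟩ := hR (n / p + 1 + R)
  set j : ℤ := n / p + 1 + R with hj
  have hp0' : (0 : ℤ) < p := by exact_mod_cast hp0
  have h1 := Int.lt_ediv_add_one_mul_self n hp0'
  have h2 := Int.ediv_mul_le n hp0'.ne'
  have hi1 : i ≤ R := by omega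
  have hi2 : -(R : ℤ) ≤ i := by omega
  refine ⟨(j - i) * p, ?_, ?_, ?_⟩
  · rw [hj]; nlinarith
  · rw [hj]; push_cast; nlinarith
  · have hclose : |(τ i - i * p) - (τ j - j * p)| < δ := by
      have hi0 : 0 ≤ (τ i - i * p) / δ := div_nonneg (by linarith [(hτ i).1]) hδ.le
      have hj0 : 0 ≤ (τ j - j * p) / δ := div_nonneg (by linarith [(hτ j).1]) hδ.le
      have a1 := Nat.floor_le hi0
      have a2 := Nat.lt_floor_add_one ((τ i - i * p) / δ)
      have a3 := Nat.floor_le hj0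
      have a4 := Nat.lt_floor_add_one ((τ j - j * p) / δ)
      have a5 : ⌊(τ i - i * p) / δ⌋₊ = ⌊(τ j - j * p) / δ⌋₊ := hi
      rw [a5] at a1 a2
      have a6 : |(τ i - i * p) / δ - (τ j - j * p) / δ| < 1 := by
        rw [abs_lt]; constructor <;> linarith
      rwa [← sub_div, abs_div, abs_of_pos hδ, div_lt_one hδ] at a6
    have hk : (((j - i) * p : ℤ) : ℝ) =
        τ j + -τ i + ((τ i - i * p) - (τ j - j * p)) := by
      push_cast; ring
    rw [hk, ← ofReal_add_three hη]
    exact (translateDist_add_le hf _ _).trans (add_le_add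
      ((translateDist_add_le hf _ _).trans (add_le_add (hτD j)
        ((translateDist_neg_le f _).trans (hτD i)))) (hD _ hclose))

/-- The set whose trace on the interval `[n, n + 1)` is `T n`, translated by `n`. -/
def glue (T : ℤ → Set ℝ) : Set ℝ := {t | Int.fract t ∈ T ⌊t⌋}

lemma glue_inter_Ico (T : ℤ → Set ℝ) (n : ℤ) :
    glue T ∩ Set.Ico (n : ℝ) (n + 1) = (fun t : ℝ => t + -n) ⁻¹' (T n ∩ Set.Ico 0 1) := by
  ext t
  simp only [glue, Set.mem_inter_iff, Set.mem_ofPred_eq, Set.mem_preimage, Set.mem_Ico]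
  constructor
  · rintro ⟨h1, h2⟩
    have hn : ⌊t⌋ = n := Int.floor_eq_iff.2 h2
    rw [Int.fract, hn, sub_eq_add_neg] at h1
    exact ⟨h1, by linarith, by linarith⟩
  · rintro ⟨h1, h2⟩
    have h3 : (n : ℝ) ≤ t ∧ t < n + 1 := ⟨by linarith, by linarith⟩
    have hn : ⌊t⌋ = n := Int.floor_eq_iff.2 h3
    rw [Int.fract, hn, sub_eq_add_neg]
    exact ⟨h1, h3⟩

lemma measurableSet_glue {T : ℤ → Set ℝ} (hT : ∀ n, MeasurableSet (T n)) :
    MeasurableSet (glue T) := by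
  have h : glue T = ⋃ n : ℤ, glue T ∩ Set.Ico (n : ℝ) (n + 1) := by
    rw [← Set.inter_iUnion, iUnion_Ico_intCast, Set.inter_univ]
  rw [h]
  refine MeasurableSet.iUnion fun n => ?_
  rw [glue_inter_Ico]
  exact (measurable_id.add_const _) ((hT n).inter measurableSet_Ico)

lemma volume_glue_inter_Ico (T : ℤ → Set ℝ) (n : ℤ) :
    volume (glue T ∩ Set.Ico (n : ℝ) (n + 1)) = unitMeasure (T n) := by
  rw [glue_inter_Ico, measure_preimage_add_right, Measure.restrict_apply' measurableSet_Ico]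

lemma volume_Icc_inter_glue_le {T : ℤ → Set ℝ} {c : ENNReal} (hT : ∀ n, unitMeasure (T n) ≤ c)
    (x : ℝ) : volume (Set.Icc x (x + 1) ∩ glue T) ≤ c + c := by
  have hsub : Set.Icc x (x + 1) ∩ glue T ⊆
      (glue T ∩ Set.Ico ((⌊x⌋ : ℤ) : ℝ) (⌊x⌋ + 1)) ∪
        (glue T ∩ Set.Ico ((⌊x⌋ + 1 : ℤ) : ℝ) ((⌊x⌋ + 1 : ℤ) + 1)) := by
    rintro t ⟨⟨h1, h2⟩, ht⟩
    rcases lt_or_ge t (⌊x⌋ + 1) with h | h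
    · exact Or.inl ⟨ht, (Int.floor_le x).trans h1, h⟩
    · refine Or.inr ⟨ht, ?_, ?_⟩ <;> push_cast
      · exact h
      · linarith [Int.lt_floor_add_one x]
  refine (measure_mono hsub).trans ((measure_union_le _ _).trans ?_)
  rw [volume_glue_inter_Ico, volume_glue_inter_Ico]
  exact add_le_add (hT _) (hT _)

open scoped symmDiff in
lemma integral_dist_indicator_glue_le {T : ℤ → Set ℝ} (hT : ∀ n, MeasurableSet (T n)) {k : ℤ}
    {c : ℝ} (hc : 0 ≤ c) (hk : ∀ n, unitMeasure (T (n + k) ∆ T n) ≤ ENNReal.ofReal c) (x : ℝ) :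
    ∫ t in x..(x + 1), dist ((glue T).indicator (fun _ => (1 : ℝ)) (t + k))
      ((glue T).indicator (fun _ => (1 : ℝ)) t) ≤ c + c := by
  have hS : MeasurableSet (glue fun n => T (n + k) ∆ T n) :=
    measurableSet_glue fun n => (hT _).symmDiff (hT _)
  have heq : (fun t => dist ((glue T).indicator (fun _ => (1 : ℝ)) (t + k))
      ((glue T).indicator (fun _ => (1 : ℝ)) t)) =
      (glue fun n => T (n + k) ∆ T n).indicator 1 := by
    ext t
    by_cases h1 : Int.fract t ∈ T (⌊t⌋ + k) <;> by_cases h2 : Int.fract t ∈ T ⌊t⌋ <;>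
      simp [h1, h2, glue, Set.mem_symmDiff]
  rw [heq, intervalIntegral.integral_of_le (by linarith), integral_indicator_one hS,
    measureReal_restrict_apply hS]
  refine ENNReal.toReal_le_of_le_ofReal (by positivity) ?_
  rw [ENNReal.ofReal_add hc hc, Set.inter_comm]
  exact (measure_mono (Set.inter_subset_inter_left _ Set.Ioc_subset_Icc_self)).trans
    (volume_Icc_inter_glue_le hk x)

/-- Danilov compactness: if `f : ℝ → 𝕏` is `S⁰`-almost periodic, then for
every `ε > 0` there exist a measurable set `T_ε` whose indicator is `S¹`-almost periodic,
with `κ(ℝ \ T_ε) < ε` (where `κ(A) = sup_ξ Leb([ξ,ξ+1] ∩ A)`), and a compact `K_ε ⊆ 𝕏`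
with `f(t) ∈ K_ε` for all `t ∈ T_ε`. -/
theorem stmt13 {X : Type*} [NormedAddCommGroup X] [NormedSpace ℝ X] [CompleteSpace X]
    [MeasurableSpace X] [BorelSpace X]
    (f : ℝ → X) (hfm : Measurable f) (hf : S0AP f) :
    ∀ ε > (0:ℝ), ∃ T : Set ℝ, MeasurableSet T ∧
      SpAP 1 (Set.indicator T (fun _ => (1:ℝ))) ∧
      (⨆ ξ : ℝ, volume (Set.Icc ξ (ξ + 1) ∩ Tᶜ)) < ENNReal.ofReal ε ∧
      ∃ Kc : Set X, IsCompact Kc ∧ ∀ t ∈ T, f t ∈ Kc := by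
  intro ε hε
  have hfs : StronglyMeasurable f :=
    stronglyMeasurable_iff_measurable_separable.2 ⟨hfm, isSeparable_range_of_measurable hfm⟩
  have hshift : ∀ n k : ℤ, mdist unitMeasure (fun t => f (t + ((n + k : ℤ) : ℝ)))
      (fun t => f (t + (n : ℝ))) ≤ translateDist f k := by
    intro n k
    have h := mdist_shift_le_translateDist f 0 n k
    rw [zero_add] at h
    rw [add_comm n k, Int.cast_add]
    exact h
  obtain ⟨T, K, hK, hTm, hTε, hTK, hTu⟩ := exists_compact_uniform_sets
    (F := fun (n : ℤ) t => f (t + (n : ℝ))) (fun n => hfs.comp_add_right _) (by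
      intro r hr
      obtain ⟨L, hL⟩ := S0AP.exists_int_translateDist_le hfs hf (half_pos hr)
      refine ⟨L + 1, fun i => i, fun n => ?_⟩
      obtain ⟨k, hk1, hk2, hk⟩ := hL (-n)
      refine ⟨(n + k).toNat, by omega, ?_⟩
      simp only [Int.toNat_of_nonneg (show 0 ≤ n + k by omega)]
      rw [mdist_comm]
      exact ((hshift n k).trans hk).trans_lt
        ((ENNReal.ofReal_lt_ofReal_iff hr).2 (half_lt_self hr)))
    (ε := ε / 4) (by positivity)
  refine ⟨glue T, measurableSet_glue hTm, fun δ hδ => ?_, ?_, K, hK, fun t ht => ?_⟩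
  · obtain ⟨η, hη, hu⟩ := hTu (δ / 2) (half_pos hδ)
    obtain ⟨L, hL⟩ := S0AP.exists_int_translateDist_le hfs hf hη
    refine ⟨L + 1, by positivity, fun a => ?_⟩
    obtain ⟨k, hk1, hk2, hk⟩ := hL ⌈a⌉
    refine ⟨k, fun x => ?_, (Int.le_ceil a).trans (by exact_mod_cast hk1), ?_⟩
    · simp only [Real.rpow_one, div_one]
      exact (integral_dist_indicator_glue_le hTm (half_pos hδ).le
        (fun n => hu _ _ ((hshift n k).trans hk)) x).trans (add_halves δ).le
    · have h1 : (k : ℝ) ≤ ⌈a⌉ + L := by exact_mod_cast hk2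
      linarith [Int.ceil_lt_add_one a]
  · refine (iSup_le fun x => volume_Icc_inter_glue_le (T := fun n => (T n)ᶜ) hTε x).trans_lt ?_
    rw [← ENNReal.ofReal_add (by positivity) (by positivity), ENNReal.ofReal_lt_ofReal_iff hε]
    linarith
  · have h := hTK ⌊t⌋ (Int.fract t) ⟨Int.fract_nonneg t, Int.fract_lt_one t⟩ ht
    simpa only [Int.fract_add_floor] using h
end
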